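/- arXiv:2003.03802 — 4 statements merged into one kernel-verified Lean document; each statement's English description precedes it below -/
import Mathlib

section
/- There exists q₀ ∈ (0,1) such that for every q ∈ (0,q₀), every u ∈ ℂ with 0 < Im u < (3/4)·(−log q)/π, and every x ∈ (0,1): Θ_q(u) ≠ 0, Θ_q(u+x) ≠ 0, and Im( Θ_q(u+x)/Θ_q(u) ) < 0. -/
open Real Complex

/-- The Jacobi theta function
`Θ_q(u) = −2 q^{1/4} sin(πu) ∏_{k≥1} (1−q^{2k})(1−2cos(2πu)q^{2k}+q^{4k})` for `q ∈ (0,1)`. -/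
noncomputable def JacobiTheta' (q : ℝ) (u : ℂ) : ℂ :=
  (-2 : ℂ) * ((q ^ ((1 : ℝ) / 4) : ℝ) : ℂ) * Complex.sin (Real.pi * u) *
    ∏' k : ℕ, ((1 - (q : ℂ) ^ (2 * (k + 1))) *
      (1 - 2 * Complex.cos (2 * Real.pi * u) * (q : ℂ) ^ (2 * (k + 1)) + (q : ℂ) ^ (4 * (k + 1))))

lemma aux_prod (f : ℕ → ℂ) (η : ℝ) (hη : 0 ≤ η)
    (h1 : ∀ k, ‖f k‖ ≤ (1/2 : ℝ)^k / 8) (h2 : ∀ k, |(f k).im| ≤ η * (1/2 : ℝ)^k) (N : ℕ) :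
    ‖∏ k ∈ Finset.range N, (1 + f k) - 1‖ ≤ 1/2 * (1 - (1/2 : ℝ)^N) ∧
    |(∏ k ∈ Finset.range N, (1 + f k)).im| ≤ 2 * η * (2 - 2 * (1/2 : ℝ)^N) := by
  induction N with
  | zero => simp
  | succ N ih =>
    obtain ⟨i1, i2⟩ := ih
    rw [Finset.prod_range_succ]
    set R := ∏ k ∈ Finset.range N, (1 + f k)
    have hr : 0 < (1/2 : ℝ)^N := by positivity
    have hr1 : (1/2 : ℝ)^N ≤ 1 := pow_le_one₀ (by norm_num) (by norm_num)
    have f1 := h1 N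
    have f2 := h2 N
    rw [pow_succ]
    set r := (1/2 : ℝ)^N
    have hR : ‖R‖ ≤ 3/2 := by
      have : ‖R‖ ≤ ‖R - 1‖ + ‖(1:ℂ)‖ := by
        simpa using norm_add_le (R - 1) 1
      rw [norm_one] at this
      linarith
    constructor
    · have : R * (1 + f N) - 1 = (R - 1) + R * f N := by ring
      rw [this]
      have h3 := norm_add_le (R - 1) (R * f N)
      rw [norm_mul] at h3
      have h4 : ‖R‖ * ‖f N‖ ≤ 3/2 * (r/8) :=
        mul_le_mul hR f1 (norm_nonneg _) (by norm_num)
      linarith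
    · have : (R * (1 + f N)).im = R.im + (R.im * (f N).re + R.re * (f N).im) := by
        simp [Complex.mul_im]; ring
      rw [this]
      have a1 : |R.im * (f N).re| ≤ (2 * η * (2 - 2 * r)) * (r / 8) := by
        rw [abs_mul]
        exact mul_le_mul i2 ((Complex.abs_re_le_norm _).trans f1) (abs_nonneg _)
          (by apply mul_nonneg <;> linarith)
      have a2 : |R.re * (f N).im| ≤ 3/2 * (η * r) := by
        rw [abs_mul]
        exact mul_le_mul ((Complex.abs_re_le_norm _).trans hR) f2 (abs_nonneg _) (by norm_num)
      have a3 := abs_add_le R.im (R.im * (f N).re + R.re * (f N).im)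
      have a4 := abs_add_le (R.im * (f N).re) (R.re * (f N).im)
      have : 0 ≤ η * r * r := by positivity
      have : 0 ≤ η * r := by positivity
      nlinarith

lemma aux_lim (f : ℕ → ℂ) (η : ℝ) (hη : 0 ≤ η)
    (h1 : ∀ k, ‖f k‖ ≤ (1/2 : ℝ)^k / 8) (h2 : ∀ k, |(f k).im| ≤ η * (1/2 : ℝ)^k) (L : ℂ)
    (hL : Filter.Tendsto (fun N => ∏ k ∈ Finset.range N, (1 + f k)) Filter.atTop (nhds L)) :
    1/2 ≤ L.re ∧ |L.im| ≤ 4 * η := by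
  have key := aux_prod f η hη h1 h2
  constructor
  · refine ge_of_tendsto ((Complex.continuous_re.tendsto L).comp hL) (Filter.Eventually.of_forall ?_)
    intro N
    have := (key N).1
    have h := (Complex.abs_re_le_norm _).trans this
    rw [Complex.sub_re, Complex.one_re] at h
    have hr : 0 < (1/2 : ℝ)^N := by positivity
    have := (abs_le.1 h).1
    simp only [Function.comp]
    linarith
  · refine le_of_tendsto (((Complex.continuous_im.tendsto L).comp hL).abs)
      (Filter.Eventually.of_forall ?_)
    intro N
    have := (key N).2
    have hr : 0 < (1/2 : ℝ)^N := by positivity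
    simp only [Function.comp]
    nlinarith

lemma aux_sin_im (z : ℂ) : (Complex.sin z).im = Real.cos z.re * Real.sinh z.im := by
  rw [Complex.sin_eq]
  simp [← Complex.ofReal_sin, ← Complex.ofReal_cos, ← Complex.ofReal_sinh, ← Complex.ofReal_cosh]

lemma aux_sin_re (z : ℂ) : (Complex.sin z).re = Real.sin z.re * Real.cosh z.im := by
  rw [Complex.sin_eq]
  simp [← Complex.ofReal_sin, ← Complex.ofReal_cos, ← Complex.ofReal_sinh, ← Complex.ofReal_cosh]

lemma aux_cos_im (z : ℂ) : (Complex.cos z).im = -(Real.sin z.re * Real.sinh z.im) := by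
  rw [Complex.cos_eq]
  simp [← Complex.ofReal_sin, ← Complex.ofReal_cos, ← Complex.ofReal_sinh, ← Complex.ofReal_cosh]

lemma aux_cos_re (z : ℂ) : (Complex.cos z).re = Real.cos z.re * Real.cosh z.im := by
  rw [Complex.cos_eq]
  simp [← Complex.ofReal_sin, ← Complex.ofReal_cos, ← Complex.ofReal_sinh, ← Complex.ofReal_cosh]

lemma aux_sin_norm (z : ℂ) : ‖Complex.sin z‖ ≤ Real.cosh z.im := by
  apply le_of_sq_le_sq _ (Real.cosh_pos _).le
  rw [Complex.sq_norm, Complex.normSq_apply, aux_sin_re, aux_sin_im]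
  nlinarith [Real.cosh_sq z.im, Real.sin_sq_add_cos_sq z.re, sq_nonneg (Real.cos z.re)]

lemma aux_cos_norm (z : ℂ) : ‖Complex.cos z‖ ≤ Real.cosh z.im := by
  apply le_of_sq_le_sq _ (Real.cosh_pos _).le
  rw [Complex.sq_norm, Complex.normSq_apply, aux_cos_re, aux_cos_im]
  nlinarith [Real.cosh_sq z.im, Real.sin_sq_add_cos_sq z.re, sq_nonneg (Real.sin z.re)]

/-- the pointwise bound for one factor -/
lemma aux_factor (c : ℂ) (P K e : ℝ) (hP : 0 ≤ P) (hK : 1 ≤ K) (he : e ≤ 1/10000)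
    (hPK : P * K ≤ e) (hc : ‖c‖ ≤ K) :
    ‖(1 - (P:ℂ)) * (1 - 2 * c * P + (P:ℂ)^2) - 1‖ ≤ 8 * e := by
  have hPe : P ≤ e := by nlinarith
  have e0 : 0 ≤ e := hP.trans hPe
  have n1 : ‖(P:ℂ)‖ = P := by simp [abs_of_nonneg hP]
  have hcP : ‖c * P‖ ≤ e := by
    rw [norm_mul, n1]; nlinarith
  have hb : ‖-2 * (c * P) + (P:ℂ)^2‖ ≤ 3 * e := by
    refine (norm_add_le _ _).trans ?_
    have h2 : ‖(-2:ℂ)‖ = 2 := by norm_num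
    rw [norm_mul, norm_pow, n1, h2]
    nlinarith
  have : (1 - (P:ℂ)) * (1 - 2 * c * P + (P:ℂ)^2) - 1
      = (-2 * (c * P) + (P:ℂ)^2) - P * (1 + (-2 * (c * P) + (P:ℂ)^2)) := by ring
  rw [this]
  refine (norm_sub_le _ _).trans ?_
  rw [norm_mul, n1]
  have h5 := norm_add_le (1:ℂ) (-2 * (c * P) + (P:ℂ)^2)
  rw [norm_one] at h5
  have h6 : P * ‖(1:ℂ) + (-2 * (c * P) + (P:ℂ)^2)‖ ≤ e * 2 :=
    mul_le_mul hPe (by linarith) (norm_nonneg _) e0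
  linarith

/-- bounds on the perturbation of the ratio of one factor -/
lemma aux_ratio (c S : ℂ) (P K H e : ℝ) (hP : 0 ≤ P) (hK : 1 ≤ K) (hH : 0 ≤ H)
    (he : e ≤ 1/10000) (hPK : P * K ≤ e) (hc : ‖c‖ ≤ K) (hS : ‖S‖ ≤ K)
    (hci : |c.im| ≤ H) (hSi : |S.im| ≤ H) :
    1 - 2 * c * P + (P:ℂ)^2 ≠ 0 ∧
    ‖4 * P * S / (1 - 2 * c * P + (P:ℂ)^2)‖ ≤ 8 * e ∧
    |(4 * P * S / (1 - 2 * c * P + (P:ℂ)^2)).im| ≤ 48 * P * H := by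
  have hPe : P ≤ e := by nlinarith
  have e0 : 0 ≤ e := hP.trans hPe
  have n1 : ‖(P:ℂ)‖ = P := by simp [abs_of_nonneg hP]
  have hcP : ‖c * P‖ ≤ e := by
    rw [norm_mul, n1]; nlinarith
  have hb : ‖-2 * (c * P) + (P:ℂ)^2‖ ≤ 3 * e := by
    refine (norm_add_le _ _).trans ?_
    have h2 : ‖(-2:ℂ)‖ = 2 := by norm_num
    rw [norm_mul, norm_pow, n1, h2]
    nlinarith
  have hDi : (1 - 2 * c * P + (P:ℂ)^2).im = -2 * P * c.im := by
    simp [pow_two]; ring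
  set D := 1 - 2 * c * P + (P:ℂ)^2 with hD
  have hD1 : ‖D - 1‖ ≤ 3 * e := by
    convert hb using 2; rw [hD]; ring
  have hDl : 1/2 ≤ ‖D‖ := by
    have := norm_sub_norm_le (1:ℂ) (1 - D)
    rw [norm_one, norm_sub_rev 1 D] at this
    have h : (1:ℂ) - (1 - D) = D := by ring
    rw [h] at this
    linarith
  have hDu : ‖D‖ ≤ 2 := by
    have := norm_add_le (D - 1) 1
    rw [norm_one, sub_add_cancel] at this
    linarith
  have hD0 : D ≠ 0 := by
    intro h; rw [h, norm_zero] at hDl; linarith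
  refine ⟨hD0, ?_, ?_⟩
  · rw [norm_div, norm_mul, norm_mul, n1, div_le_iff₀ (by linarith)]
    norm_num
    have : P * ‖S‖ ≤ e := (mul_le_mul_of_nonneg_left hS hP).trans hPK
    nlinarith
  · have hE : (4 * P * S / D).im = 4 * P * (S.im * D.re - S.re * D.im) / ‖D‖^2 := by
      rw [Complex.div_im, Complex.sq_norm]
      simp
      ring
    have b1 : |S.im * D.re| ≤ H * 2 := by
      rw [abs_mul]
      exact mul_le_mul hSi ((Complex.abs_re_le_norm _).trans hDu) (abs_nonneg _) hH
    have b2 : |S.re * D.im| ≤ H := by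
      rw [hDi, abs_mul, abs_mul, abs_mul, abs_of_nonneg hP]
      norm_num
      have h1 : |S.re| ≤ K := (Complex.abs_re_le_norm _).trans hS
      have h2 : P * |S.re| ≤ e := (mul_le_mul_of_nonneg_left h1 hP).trans hPK
      have h3 : P * |S.re| * |c.im| ≤ e * H := mul_le_mul h2 hci (abs_nonneg _) e0
      nlinarith
    have b3 := abs_sub (S.im * D.re) (S.re * D.im)
    rw [hE, abs_div, abs_mul, abs_mul, abs_of_nonneg hP, abs_of_nonneg (sq_nonneg ‖D‖),
      div_le_iff₀ (by positivity)]
    norm_num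
    have q1 : 1/4 ≤ ‖D‖^2 := by nlinarith
    have q2 : 0 ≤ P * H := by positivity
    have q3 : P * |S.im * D.re - S.re * D.im| ≤ P * (3 * H) :=
      mul_le_mul_of_nonneg_left (by linarith) hP
    nlinarith

theorem exists_q0_theta_ratio_im_neg :
    ∃ q₀ ∈ Set.Ioo (0 : ℝ) 1, ∀ q ∈ Set.Ioo (0 : ℝ) q₀, ∀ u : ℂ,
      0 < u.im → u.im < 3 / 4 * (-Real.log q) / π → ∀ x ∈ Set.Ioo (0 : ℝ) 1,
      JacobiTheta' q u ≠ 0 ∧ JacobiTheta' q (u + (x : ℂ)) ≠ 0 ∧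
        (JacobiTheta' q (u + (x : ℂ)) / JacobiTheta' q u).im < 0 := by
  refine ⟨1/10^8, by norm_num, ?_⟩
  rintro q ⟨hq0, hq1⟩ u hu0 hu1 x ⟨hx0, hx1⟩
  have hs0 : 0 < Real.sin (π * x) :=
    Real.sin_pos_of_pos_of_lt_pi (by positivity) (by nlinarith [Real.pi_pos])
  have hs1 : Real.sin (π * x) ≤ 1 := Real.sin_le_one _
  set s := Real.sin (π * x) with hs
  set Y := 2 * π * u.im with hY
  have hY0 : 0 < Y := by positivity
  set K := Real.cosh Y with hKdef
  set H := Real.sinh Y with hHdef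
  have hK : 1 ≤ K := Real.one_le_cosh Y
  have hH : 0 < H := Real.sinh_pos_iff.2 hY0
  have hYq : Y ≤ -(3/2) * Real.log q := by
    rw [lt_div_iff₀ Real.pi_pos] at hu1
    rw [hY]; linarith
  -- q^2 K ≤ 1/10000
  have hq2K : q^2 * K ≤ 1/10000 := by
    have h1 : K ≤ Real.exp Y := by
      rw [hKdef, Real.cosh_eq]
      have : Real.exp (-Y) ≤ Real.exp Y := Real.exp_le_exp.2 (by linarith)
      linarith
    have h2 : Real.exp Y ≤ Real.exp (-(3/2) * Real.log q) := Real.exp_le_exp.2 hYq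
    have h3 : q^2 * Real.exp (-(3/2) * Real.log q) = Real.exp (Real.log q / 2) := by
      have : q^2 = Real.exp (2 * Real.log q) := by
        rw [two_mul, Real.exp_add, Real.exp_log hq0]; ring
      rw [this, ← Real.exp_add]; congr 1; ring
    have h4 : Real.exp (Real.log q / 2) ≤ 1/10000 := by
      apply le_of_sq_le_sq _ (by norm_num)
      rw [pow_two, ← Real.exp_add, add_halves, Real.exp_log hq0]
      norm_num at hq1 ⊢; linarith
    calc q^2 * K ≤ q^2 * Real.exp (-(3/2) * Real.log q) := by gcongr; exact h1.trans h2
      _ ≤ _ := by rw [h3]; exact h4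
  -- powers
  have hpow : ∀ k : ℕ, q^(2*(k+1)) ≤ q^2 * (1/2)^k := by
    intro k
    have : q^(2*(k+1)) = q^2 * (q^2)^k := by rw [← pow_mul, ← pow_add]; congr 1; ring
    rw [this]
    have : q^2 ≤ 1/2 := by nlinarith
    gcongr
  have hP0 : ∀ k : ℕ, 0 < q^(2*(k+1)) := fun k => by positivity
  have hPK : ∀ k : ℕ, q^(2*(k+1)) * K ≤ (1/2)^k / 10000 := by
    intro k
    have h1 : q^(2*(k+1)) * K ≤ q^2 * (1/2)^k * K :=
      mul_le_mul_of_nonneg_right (hpow k) (by linarith)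
    have h2 : (q^2 * K) * (1/2:ℝ)^k ≤ 1/10000 * (1/2)^k :=
      mul_le_mul_of_nonneg_right hq2K (by positivity)
    linarith
  have hek : ∀ k : ℕ, (1/2:ℝ)^k / 10000 ≤ 1/10000 := by
    intro k
    have : (1/2:ℝ)^k ≤ 1 := pow_le_one₀ (by norm_num) (by norm_num)
    linarith
  -- the product
  let F : ℂ → ℕ → ℂ := fun v k => (1 - (q : ℂ) ^ (2 * (k + 1))) *
      (1 - 2 * Complex.cos (2 * Real.pi * v) * (q : ℂ) ^ (2 * (k + 1)) + (q : ℂ) ^ (4 * (k + 1)))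
  have hF : ∀ v k, F v k = (1 - ((q^(2*(k+1)) : ℝ) : ℂ)) * (1 - 2 * Complex.cos (2 * Real.pi * v) *
      ((q^(2*(k+1)) : ℝ) : ℂ) + ((q^(2*(k+1)) : ℝ) : ℂ)^2) := by
    intro v k
    simp only [F]
    push_cast
    rw [← pow_mul]
    ring_nf
  have hTh : ∀ v, JacobiTheta' q v = (-2 : ℂ) * ((q ^ ((1 : ℝ) / 4) : ℝ) : ℂ) *
      Complex.sin (Real.pi * v) * ∏' k, F v k := fun v => rfl
  have him : ∀ v : ℂ, v.im = u.im → (2 * π * v : ℂ).im = Y := by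
    intro v hv; simp [hv, hY]
  have hFb : ∀ v : ℂ, v.im = u.im → ∀ k, ‖F v k - 1‖ ≤ (1/2)^k / 8 := by
    intro v hv k
    rw [hF]
    have hc : ‖Complex.cos (2 * π * v)‖ ≤ K := by
      have := aux_cos_norm (2 * π * v); rwa [him v hv] at this
    have := aux_factor _ _ K _ (hP0 k).le hK (hek k) (hPK k) hc
    have h : 0 < (1/2:ℝ)^k := by positivity
    linarith
  have hFm : ∀ v : ℂ, v.im = u.im →
      Filter.Tendsto (fun N => ∏ k ∈ Finset.range N, F v k) Filter.atTop (nhds (∏' k, F v k)) := by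
    intro v hv
    have hsum : Summable (fun k => ‖F v k - 1‖) := by
      refine Summable.of_nonneg_of_le (fun _ => norm_nonneg _) (hFb v hv) ?_
      exact (summable_geometric_of_lt_one (by norm_num) (by norm_num)).div_const 8
    have hm := multipliable_one_add_of_summable hsum
    have : (fun k => 1 + (F v k - 1)) = F v := by ext k; ring
    rw [this] at hm
    exact hm.hasProd.tendsto_prod_nat
  have hT0 : ∀ v : ℂ, v.im = u.im → ∏' k, F v k ≠ 0 := by
    intro v hv h0
    have := aux_lim (fun k => F v k - 1) (1/8) (by norm_num) (hFb v hv)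
      (fun k => (Complex.abs_im_le_norm _).trans ((hFb v hv k).trans (by linarith)))
      (∏' k, F v k) (by simpa using hFm v hv)
    rw [h0] at this
    norm_num at this
  have hsin0 : ∀ v : ℂ, v.im = u.im → Complex.sin (π * v) ≠ 0 := by
    intro v hv h0
    obtain ⟨k, hk⟩ := Complex.sin_eq_zero_iff.1 h0
    have := congrArg Complex.im hk
    simp [hv] at this
    linarith
  have hcq : (-2 : ℂ) * ((q ^ ((1 : ℝ) / 4) : ℝ) : ℂ) ≠ 0 := by
    have : 0 < q ^ ((1 : ℝ) / 4) := Real.rpow_pos_of_pos hq0 _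
    have : ((q ^ ((1 : ℝ) / 4) : ℝ) : ℂ) ≠ 0 := by exact_mod_cast this.ne'
    exact mul_ne_zero (by norm_num) this
  have hTh0 : ∀ v : ℂ, v.im = u.im → JacobiTheta' q v ≠ 0 := by
    intro v hv
    rw [hTh]
    exact mul_ne_zero (mul_ne_zero hcq (hsin0 v hv)) (hT0 v hv)
  have hux : (u + (x:ℂ)).im = u.im := by simp
  refine ⟨hTh0 u rfl, hTh0 _ hux, ?_⟩
  -- ratio
  set R := (∏' k, F (u + x) k) / ∏' k, F u k with hR
  have hRt : Filter.Tendsto (fun N => ∏ k ∈ Finset.range N, (F (u + x) k / F u k))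
      Filter.atTop (nhds R) := by
    have := (hFm (u+x) hux).div (hFm u rfl) (hT0 u rfl)
    simp only [Finset.prod_div_distrib]
    exact this
  let S : ℂ := Complex.sin (2 * π * u + π * x)
  have hSim : (2 * π * u + π * x : ℂ).im = Y := by simp [hY]
  have hSn : ‖S‖ ≤ K := by
    have := aux_sin_norm (2 * π * u + π * x); rwa [hSim] at this
  have hSi : |S.im| ≤ H := by
    simp only [S]
    rw [aux_sin_im, hSim, abs_mul, abs_of_pos hH]
    have := Real.abs_cos_le_one (2 * π * u + π * x : ℂ).re
    nlinarith
  have hcn : ‖Complex.cos (2 * π * u)‖ ≤ K := by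
    have := aux_cos_norm (2 * π * u); rwa [him u rfl] at this
  have hci : |(Complex.cos (2 * π * u)).im| ≤ H := by
    rw [aux_cos_im, him u rfl, abs_neg, abs_mul, abs_of_pos hH]
    have := Real.abs_sin_le_one (2 * π * u : ℂ).re
    nlinarith
  let a : ℕ → ℂ := fun k => 4 * ((q^(2*(k+1)) : ℝ) : ℂ) * S /
    (1 - 2 * Complex.cos (2 * Real.pi * u) *
      ((q^(2*(k+1)) : ℝ) : ℂ) + ((q^(2*(k+1)) : ℝ) : ℂ)^2)
  have hrat := fun k => aux_ratio _ S _ K H _ (hP0 k).le hK hH.le (hek k) (hPK k) hcn hSn hci hSi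
  have hcosd : Complex.cos (2 * π * (u + x)) = Complex.cos (2 * π * u) - 2 * (s:ℂ) * S := by
    have h := Complex.cos_sub_cos (2 * π * (u + x)) (2 * π * u)
    have h1 : ((2 * π * (u + x) + 2 * π * u) / 2 : ℂ) = 2 * π * u + π * x := by ring
    have h2 : ((2 * π * (u + x) - 2 * π * u) / 2 : ℂ) = π * x := by ring
    rw [h1, h2] at h
    have h3 : (s : ℂ) = Complex.sin (π * x) := by rw [hs]; push_cast; rfl
    rw [h3]
    simp only [S]
    linear_combination h
  have hfac : ∀ k, F (u + x) k / F u k = 1 + s * a k := by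
    intro k
    have hD := (hrat k).1
    have hP1 : (1 - ((q^(2*(k+1)) : ℝ) : ℂ)) ≠ 0 := by
      have : q^(2*(k+1)) < 1 := pow_lt_one₀ hq0.le (by norm_num at hq1; linarith) (by omega)
      intro h
      have h' : (1:ℝ) - q^(2*(k+1)) = 0 := by exact_mod_cast h
      linarith
    rw [hF, hF, hcosd, mul_div_mul_left _ _ hP1, div_eq_iff hD]
    simp only [a]
    rw [add_mul, mul_assoc (s:ℂ), div_mul_cancel₀ _ hD]
    ring
  have hmain := aux_lim (fun k => s * a k) (48 * s * q^2 * H) (by positivity)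
    (by
      intro k
      have h1 := (hrat k).2.1
      have h : 0 < (1/2:ℝ)^k := by positivity
      rw [norm_mul, Complex.norm_real, Real.norm_of_nonneg hs0.le]
      have h2 : s * ‖a k‖ ≤ 1 * ‖a k‖ := mul_le_mul_of_nonneg_right hs1 (norm_nonneg _)
      have h3 : ‖a k‖ ≤ 8 * ((1/2)^k / 10000) := h1
      linarith)
    (by
      intro k
      have h1 : |(a k).im| ≤ 48 * q^(2*(k+1)) * H := (hrat k).2.2
      rw [Complex.im_ofReal_mul, abs_mul, abs_of_pos hs0]
      have h2 := mul_le_mul_of_nonneg_left h1 hs0.le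
      have h3 : (48 * s * H) * q^(2*(k+1)) ≤ (48 * s * H) * (q^2 * (1/2)^k) :=
        mul_le_mul_of_nonneg_left (hpow k) (by positivity)
      linarith)
    R (by simpa only [← hfac] using hRt)
  obtain ⟨hRre, hRim⟩ := hmain
  -- final
  set A := Complex.sin (π * (u + x)) with hA
  set B := Complex.sin (π * u) with hB
  have hB0 : B ≠ 0 := hsin0 u rfl
  have hquot : JacobiTheta' q (u + x) / JacobiTheta' q u = (A / B) * R := by
    rw [hTh, hTh, hR, mul_assoc, mul_assoc _ B, mul_div_mul_left _ _ hcq, mul_div_mul_comm]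
  rw [hquot]
  have hre : (π * u : ℂ).re = π * u.re := by simp
  have hie : (π * u : ℂ).im = π * u.im := by simp
  have hre' : (π * (u + x) : ℂ).re = π * u.re + π * x := by simp; ring
  have hie' : (π * (u + x) : ℂ).im = π * u.im := by simp
  have hAr := aux_sin_re (π * (u + x))
  have hAi := aux_sin_im (π * (u + x))
  have hBr := aux_sin_re (π * u)
  have hBi := aux_sin_im (π * u)
  rw [hre', hie', ← hA] at hAr hAi
  rw [hre, hie, ← hB] at hBr hBi
  have hY2 : Y = 2 * (π * u.im) := by rw [hY]; ring
  have hH2 : H = 2 * Real.sinh (π * u.im) * Real.cosh (π * u.im) := by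
    rw [hHdef, hY2, Real.sinh_two_mul]
  have hK2 : K = Real.cosh (π * u.im)^2 + Real.sinh (π * u.im)^2 := by
    rw [hKdef, hY2, Real.cosh_two_mul]
  have hABi : A.im * B.re - A.re * B.im = - (s * H / 2) := by
    have hss : s = Real.sin (π * u.re + π * x) * Real.cos (π * u.re)
        - Real.cos (π * u.re + π * x) * Real.sin (π * u.re) := by
      rw [← Real.sin_sub, add_sub_cancel_left]
    rw [hAr, hAi, hBr, hBi, hH2, hss]; ring
  have hABr : |A.re * B.re + A.im * B.im| ≤ K := by
    have e1 : A.re * B.re + A.im * B.im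
        = (Real.sin (π * u.re + π * x) * Real.sin (π * u.re)) * Real.cosh (π * u.im)^2
         + (Real.cos (π * u.re + π * x) * Real.cos (π * u.re)) * Real.sinh (π * u.im)^2 := by
      rw [hAr, hAi, hBr, hBi]; ring
    rw [e1, hK2]
    refine (abs_add_le _ _).trans ?_
    rw [abs_mul, abs_mul (Real.cos (π * u.re + π * x) * Real.cos (π * u.re)), abs_mul, abs_mul,
      abs_of_nonneg (sq_nonneg (Real.cosh (π * u.im))),
      abs_of_nonneg (sq_nonneg (Real.sinh (π * u.im)))]
    have t1 := mul_le_one₀ (Real.abs_sin_le_one (π * u.re + π * x)) (abs_nonneg _)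
      (Real.abs_sin_le_one (π * u.re))
    have t2 := mul_le_one₀ (Real.abs_cos_le_one (π * u.re + π * x)) (abs_nonneg _)
      (Real.abs_cos_le_one (π * u.re))
    have := mul_le_mul_of_nonneg_right t1 (sq_nonneg (Real.cosh (π * u.im)))
    have := mul_le_mul_of_nonneg_right t2 (sq_nonneg (Real.sinh (π * u.im)))
    linarith
  have hfin : (A / B * R).im = ((A.re * B.re + A.im * B.im) * R.im
      + (A.im * B.re - A.re * B.im) * R.re) / Complex.normSq B := by
    rw [Complex.mul_im, Complex.div_re A B, Complex.div_im A B]; ring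
  rw [hfin, hABi]
  apply div_neg_of_neg_of_pos _ (Complex.normSq_pos.2 hB0)
  have g1 : (A.re * B.re + A.im * B.im) * R.im ≤ K * (4 * (48 * s * q^2 * H)) := by
    refine (le_abs_self _).trans ?_
    rw [abs_mul]
    exact mul_le_mul hABr hRim (abs_nonneg _) (by linarith)
  have hsH : 0 < s * H := by positivity
  have g2 : (s * H) * (q^2 * K) ≤ (s * H) * (1/10000) := mul_le_mul_of_nonneg_left hq2K hsH.le
  have g3 : s * H * (1/2) ≤ s * H * R.re := mul_le_mul_of_nonneg_left hRre hsH.le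
  linarith
end

section
/- Fix γ ∈ (0,2) with γ² irrational, an integer N ≥ 1 with N·γ² < 4, and integers m, n with 1 ≤ m ≤ N and n ≥ 1. Set α := −Nγ and define f : ℂ → ℂ by f(P) := ∏_{j=1}^N Γ(1 + jγ²/4 + iγP/2)·Γ(1 + jγ²/4 − iγP/2), where Γ is the complex Gamma function. Then, as P → P_{m,n} with P ≠ P_{m,n}, one has (P − P_{m,n})·f(P) → (1/(2P_{m,n}))·R_{γ,m,n}(α)·f(P_{−m,n}); in particular f has a simple pole at P_{m,n} with residue (1/(2P_{m,n}))·R_{γ,m,n}(α)·f(P_{−m,n}). -/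
open Real Complex Filter

/-- `P_{m,n} = 2in/γ + iγm/2`. -/
noncomputable def Pmn (γ : ℝ) (m n : ℤ) : ℂ :=
  2 * Complex.I * (n : ℂ) / (γ : ℂ) + Complex.I * (γ : ℂ) * (m : ℂ) / 2

/-- The coefficient `R_{γ,m,n}(α)` of Zamolodchikov's recursion. -/
noncomputable def Rcoef (γ : ℝ) (α : ℂ) (m n : ℤ) : ℂ :=
  2 * (∏ p ∈ Finset.Icc (-m) (m - 1) ×ˢ Finset.Icc (-n) (n - 1),
        (((γ / 2 + 2 / γ : ℝ) : ℂ) - α / 2 + (p.1 : ℂ) * (γ : ℂ) / 2 + 2 * (p.2 : ℂ) / (γ : ℂ))) /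
    ∏ p ∈ ((Finset.Icc (1 - m) m ×ˢ Finset.Icc (1 - n) n).erase (0, 0)).erase (m, n),
        ((p.1 : ℂ) * (γ : ℂ) / 2 + 2 * (p.2 : ℂ) / (γ : ℂ))

/-- The product of Gamma factors `f(P) = ∏_{j=1}^N Γ(1+jγ²/4+iγP/2)Γ(1+jγ²/4−iγP/2)`. -/
noncomputable def gammaProd (N : ℕ) (γ : ℝ) (P : ℂ) : ℂ :=
  ∏ j ∈ Finset.Icc 1 N,
    (Complex.Gamma (1 + (j : ℂ) * (γ : ℂ) ^ 2 / 4 + Complex.I * (γ : ℂ) * P / 2) *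
      Complex.Gamma (1 + (j : ℂ) * (γ : ℂ) ^ 2 / 4 - Complex.I * (γ : ℂ) * P / 2))

lemma aux_ne {γ : ℝ} (hirr : Irrational (γ ^ 2)) (k l : ℤ)
    (h : (k : ℂ) * ((γ : ℂ) ^ 2 / 4) + l = 0) : k = 0 ∧ l = 0 := by
  have h' : (k : ℝ) * (γ ^ 2 / 4) + l = 0 := by exact_mod_cast h
  have hk : k = 0 := by
    by_contra hk
    have hk' : (k : ℝ) ≠ 0 := by exact_mod_cast hk
    apply hirr
    refine ⟨(-4 * l / k : ℚ), ?_⟩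
    push_cast
    field_simp
    linarith
  subst hk
  refine ⟨rfl, ?_⟩
  simpa using h'

lemma Icc_step (n : ℕ) : Finset.Icc (1 - ((n + 1 : ℕ) : ℤ)) ((n + 1 : ℕ) : ℤ) =
    insert (-(n : ℤ)) (insert ((n : ℤ) + 1) (Finset.Icc (1 - (n : ℤ)) n)) := by
  ext x; simp only [Finset.mem_Icc, Finset.mem_insert]; omega

lemma gamma_shift (n : ℕ) (w : ℂ) (h : ∀ l ∈ Finset.Icc (1 - (n : ℤ)) n, w + (l : ℂ) ≠ 0) :
    Complex.Gamma (1 + w + n) =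
      Complex.Gamma (1 + w - n) * ∏ l ∈ Finset.Icc (1 - (n : ℤ)) n, (w + (l : ℂ)) := by
  induction n with
  | zero => simp
  | succ n ih =>
    rw [Icc_step] at h ⊢
    have ih' := ih (fun l hl => h l (by simp only [Finset.mem_insert]; tauto))
    rw [Finset.prod_insert (by simp only [Finset.mem_Icc, Finset.mem_insert]; omega),
      Finset.prod_insert (by simp only [Finset.mem_Icc]; omega)]
    have h1 : w - n ≠ 0 := by simpa [sub_eq_add_neg] using h (-(n : ℤ)) (by simp)
    have h2 : 1 + w + n ≠ 0 := by
      have := h ((n : ℤ) + 1) (by simp)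
      push_cast at this
      intro h0; apply this; linear_combination h0
    have e1 : (1 + w + ((n + 1 : ℕ) : ℂ)) = (1 + w + n) + 1 := by push_cast; ring
    have e2 : (1 + w + -(n : ℂ)) = (w - n) + 1 := by ring
    have e3 : (1 + w - ((n + 1 : ℕ) : ℂ)) = w - n := by push_cast; ring
    rw [e1, Complex.Gamma_add_one _ h2, ih', e3, sub_eq_add_neg (1 + w), e2,
      Complex.Gamma_add_one _ h1]
    push_cast
    ring

lemma telescope (C : ℤ → ℂ) (hC : ∀ k, C k ≠ 0) (m : ℤ) (hm : 1 ≤ m) (N : ℕ) :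
    ∏ j ∈ Finset.Icc 1 N, (C ((j : ℤ) + m) / C ((j : ℤ) - m)) =
      (∏ k ∈ Finset.Icc ((N : ℤ) + 1 - m) (N + m), C k) / ∏ k ∈ Finset.Icc (1 - m) m, C k := by
  have hD : ∏ k ∈ Finset.Icc (1 - m) m, C k ≠ 0 := Finset.prod_ne_zero_iff.mpr fun k _ => hC k
  induction N with
  | zero => simp [div_self hD]
  | succ N ih =>
    rw [Finset.prod_Icc_succ_top (by omega), ih]
    have e1 : Finset.Icc ((N : ℤ) + 1 - m) (N + m) =
      insert ((N : ℤ) + 1 - m) (Finset.Icc ((N : ℤ) + 2 - m) (N + m)) := by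
      ext x; simp only [Finset.mem_Icc, Finset.mem_insert]; omega
    have e2 : Finset.Icc (((N + 1 : ℕ) : ℤ) + 1 - m) ((N + 1 : ℕ) + m) =
      insert ((N : ℤ) + 1 + m) (Finset.Icc ((N : ℤ) + 2 - m) (N + m)) := by
      ext x; simp only [Finset.mem_Icc, Finset.mem_insert]; omega
    rw [e1, e2, Finset.prod_insert (by simp only [Finset.mem_Icc]; omega),
      Finset.prod_insert (by simp only [Finset.mem_Icc]; omega)]
    have := hC ((N : ℤ) + 1 - m)
    push_cast
    field_simp

/-- Regularised linear factor. -/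
noncomputable def cfac (t : ℂ) (k l : ℤ) : ℂ := if k = 0 ∧ l = 0 then 1 else (k : ℂ) * t + l

lemma cfac_ne {γ : ℝ} (hirr : Irrational (γ ^ 2)) (k l : ℤ) : cfac ((γ : ℂ) ^ 2 / 4) k l ≠ 0 := by
  unfold cfac
  split_ifs with h
  · exact one_ne_zero
  · exact fun h0 => h (aux_ne hirr k l h0)

lemma Rcoef_eq {γ : ℝ} (hγ : γ ≠ 0) (hirr : Irrational (γ ^ 2)) (N : ℕ) (m n : ℤ) (hm : 1 ≤ m)
    (hmN : m ≤ (N : ℤ)) (hn : 1 ≤ n) :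
    (1 / (2 * Pmn γ m n)) * Rcoef γ (-(N : ℂ) * (γ : ℂ)) m n =
    2 / (Complex.I * γ) *
     ((∏ k ∈ Finset.Icc ((N : ℤ) + 1 - m) (N + m), ∏ l ∈ Finset.Icc (1 - n) n,
        cfac ((γ : ℂ) ^ 2 / 4) k l) /
      ∏ k ∈ Finset.Icc (1 - m) m, ∏ l ∈ Finset.Icc (1 - n) n, cfac ((γ : ℂ) ^ 2 / 4) k l) := by
  have hg : (γ : ℂ) ≠ 0 := by exact_mod_cast hγ
  set t : ℂ := (γ : ℂ) ^ 2 / 4 with ht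
  set r : ℂ := 2 / (γ : ℂ) with hr
  have hr0 : r ≠ 0 := by simp [hr, hg]
  have hcard : ((m + 1 - (1 - m)).toNat * (n + 1 - (1 - n)).toNat) =
     ((N + m + 1 - ((N : ℤ) + 1 - m)).toNat * (n + 1 - (1 - n)).toNat) := by
    congr 2; ring
  have hnum : (∏ p ∈ Finset.Icc (-m) (m - 1) ×ˢ Finset.Icc (-n) (n - 1),
        (((γ / 2 + 2 / γ : ℝ) : ℂ) - (-(N : ℂ) * (γ : ℂ)) / 2 + (p.1 : ℂ) * (γ : ℂ) / 2
          + 2 * (p.2 : ℂ) / (γ : ℂ))) =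
      ∏ p ∈ Finset.Icc ((N : ℤ) + 1 - m) (N + m) ×ˢ Finset.Icc (1 - n) n,
        (r * cfac t p.1 p.2) := by
    refine Finset.prod_bij' (fun p _ => (p.1 + N + 1, p.2 + 1)) (fun p _ => (p.1 - N - 1, p.2 - 1))
      ?_ ?_ ?_ ?_ ?_
    · rintro ⟨a, b⟩; simp only [Finset.mem_product, Finset.mem_Icc]; omega
    · rintro ⟨a, b⟩; simp only [Finset.mem_product, Finset.mem_Icc]; omega
    · rintro ⟨a, b⟩ _; ext <;> dsimp only <;> omega
    · rintro ⟨a, b⟩ _; ext <;> dsimp only <;> omega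
    · rintro ⟨a, b⟩ h
      simp only [Finset.mem_product, Finset.mem_Icc] at h
      have : ¬ (a + N + 1 = 0 ∧ b + 1 = 0) := by omega
      simp only [cfac, this, if_false, hr, ht]
      push_cast
      field_simp
      ring
  have hden : (∏ p ∈ ((Finset.Icc (1 - m) m ×ˢ Finset.Icc (1 - n) n).erase (0, 0)).erase (m, n),
        ((p.1 : ℂ) * (γ : ℂ) / 2 + 2 * (p.2 : ℂ) / (γ : ℂ))) =
      ∏ p ∈ ((Finset.Icc (1 - m) m ×ˢ Finset.Icc (1 - n) n).erase (0, 0)).erase (m, n),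
        (r * cfac t p.1 p.2) := by
    refine Finset.prod_congr rfl ?_
    rintro ⟨a, b⟩ h
    simp only [Finset.mem_erase, ne_eq, Prod.mk.injEq] at h
    simp only [cfac, h.2.1, if_false, hr, ht]
    field_simp
    ring
  have hmn : ¬ (m = 0 ∧ n = 0) := by omega
  have hall : r * (r * cfac t m n * ∏ p ∈ ((Finset.Icc (1 - m) m ×ˢ Finset.Icc (1 - n) n).erase
        (0, 0)).erase (m, n), (r * cfac t p.1 p.2)) =
      ∏ p ∈ Finset.Icc (1 - m) m ×ˢ Finset.Icc (1 - n) n, (r * cfac t p.1 p.2) := by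
    rw [Finset.mul_prod_erase _ (fun p : ℤ × ℤ => r * cfac t p.1 p.2) (a := (m, n))
      (by simp only [Finset.mem_erase, Finset.mem_product, Finset.mem_Icc, ne_eq, Prod.mk.injEq]
          omega)]
    rw [← Finset.mul_prod_erase (Finset.Icc (1 - m) m ×ˢ Finset.Icc (1 - n) n)
      (fun p : ℤ × ℤ => r * cfac t p.1 p.2) (a := (0, 0))
      (by simp only [Finset.mem_product, Finset.mem_Icc]; omega)]
    simp [cfac]
  have hP : Pmn γ m n = Complex.I * (r * cfac t m n) := by
    simp only [Pmn, cfac, hmn, if_false, hr, ht]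
    field_simp
    ring
  have hE0 : ∏ p ∈ ((Finset.Icc (1 - m) m ×ˢ Finset.Icc (1 - n) n).erase
        (0, 0)).erase (m, n), (r * cfac t p.1 p.2) ≠ 0 :=
    Finset.prod_ne_zero_iff.mpr fun p _ => mul_ne_zero hr0 (cfac_ne hirr _ _)
  have hc0 : cfac t m n ≠ 0 := cfac_ne hirr _ _
  have hI := Complex.I_ne_zero
  have key : (∏ k ∈ Finset.Icc ((N : ℤ) + 1 - m) (N + m), ∏ l ∈ Finset.Icc (1 - n) n, cfac t k l) /
      (∏ k ∈ Finset.Icc (1 - m) m, ∏ l ∈ Finset.Icc (1 - n) n, cfac t k l) =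
      (∏ p ∈ Finset.Icc ((N : ℤ) + 1 - m) (N + m) ×ˢ Finset.Icc (1 - n) n, (r * cfac t p.1 p.2)) /
      ∏ p ∈ Finset.Icc (1 - m) m ×ˢ Finset.Icc (1 - n) n, (r * cfac t p.1 p.2) := by
    rw [Finset.prod_mul_distrib, Finset.prod_mul_distrib, Finset.prod_const, Finset.prod_const,
      Finset.card_product, Finset.card_product, Int.card_Icc, Int.card_Icc, Int.card_Icc, hcard,
      mul_div_mul_left _ _ (pow_ne_zero _ hr0), Finset.prod_product, Finset.prod_product]
  rw [key, ← hall, Rcoef, hnum, hden, hP]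
  have : 2 / (Complex.I * γ) = r / Complex.I := by rw [hr]; field_simp
  rw [this]
  field_simp

lemma gamma_cont {γ : ℝ} (hirr : Irrational (γ ^ 2)) (k a : ℤ) (h : k = 0 → 1 ≤ a) :
    ContinuousAt Complex.Gamma ((k : ℂ) * ((γ : ℂ) ^ 2 / 4) + a) := by
  refine (Complex.differentiableAt_Gamma _ ?_).continuousAt
  intro i hi
  have := aux_ne hirr k (a + i) (by push_cast; linear_combination hi)
  have := h this.1
  omega

lemma factor_tendsto {γ : ℝ} (hirr : Irrational (γ ^ 2)) (n : ℕ) (hn : 1 ≤ n) (k : ℤ) :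
    Tendsto (fun s : ℂ => (if k = 0 then s else 1) *
        Complex.Gamma (1 + ((k : ℂ) * ((γ : ℂ) ^ 2 / 4) + s) - n))
      (nhdsWithin 0 {0}ᶜ)
      (nhds (Complex.Gamma (1 + (k : ℂ) * ((γ : ℂ) ^ 2 / 4) + n) /
        ∏ l ∈ Finset.Icc (1 - (n : ℤ)) n, cfac ((γ : ℂ) ^ 2 / 4) k l)) := by
  by_cases hk : k = 0
  · subst hk
    simp only [if_true, Int.cast_zero, zero_mul, zero_add, add_zero]
    have h0mem : (0 : ℤ) ∈ Finset.Icc (1 - (n : ℤ)) n := by simp only [Finset.mem_Icc]; omega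
    have hcf : ∏ l ∈ Finset.Icc (1 - (n : ℤ)) n, cfac ((γ : ℂ) ^ 2 / 4) 0 l =
        ∏ l ∈ (Finset.Icc (1 - (n : ℤ)) n).erase 0, ((0 : ℂ) + l) := by
      rw [← Finset.mul_prod_erase _ _ h0mem]
      have : cfac ((γ : ℂ) ^ 2 / 4) 0 0 = 1 := by simp [cfac]
      rw [this, one_mul]
      refine Finset.prod_congr rfl fun l hl => ?_
      have := (Finset.mem_erase.mp hl).1
      simp [cfac, this]
    have hcont : ContinuousAt (fun s : ℂ => Complex.Gamma (1 + s + n) /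
        ∏ l ∈ (Finset.Icc (1 - (n : ℤ)) n).erase 0, (s + (l : ℂ))) 0 := by
      refine ContinuousAt.div ?_ (by fun_prop) ?_
      · refine ContinuousAt.comp (g := Complex.Gamma) (f := fun s : ℂ => 1 + s + n) ?_ (by fun_prop)
        have := gamma_cont hirr 0 (1 + n) (by intro; omega)
        convert this using 1
        push_cast; ring
      · refine Finset.prod_ne_zero_iff.mpr fun l hl => ?_
        have := (Finset.mem_erase.mp hl).1
        simpa using this
    have hlim := hcont.tendsto.mono_left (nhdsWithin_le_nhds (s := {0}ᶜ))
    simp only [add_zero] at hlim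
    rw [hcf]
    refine hlim.congr' ?_
    have hball : ∀ᶠ s : ℂ in nhdsWithin 0 {0}ᶜ, ‖s‖ < 1 := by
      refine nhdsWithin_le_nhds ?_
      have := Metric.ball_mem_nhds (0 : ℂ) one_pos
      filter_upwards [this] with s hs
      simpa using hs
    filter_upwards [hball, self_mem_nhdsWithin] with s hs hs0
    have hs0' : s ≠ 0 := hs0
    have hne : ∀ l : ℤ, s + (l : ℂ) ≠ 0 := by
      intro l hl
      have e : s = -(l : ℂ) := by linear_combination hl
      rw [e, norm_neg, Complex.norm_intCast] at hs
      have : |l| < 1 := by exact_mod_cast hs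
      rw [Int.abs_lt_one_iff] at this
      subst this
      simp at e
      exact hs0' e
    rw [gamma_shift n s fun l _ => hne l, ← Finset.mul_prod_erase _ _ h0mem]
    have : ∏ l ∈ (Finset.Icc (1 - (n : ℤ)) n).erase 0, (s + (l : ℂ)) ≠ 0 :=
      Finset.prod_ne_zero_iff.mpr fun l _ => hne l
    field_simp
    simp [mul_comm]
  · simp only [hk, if_false, one_mul]
    have hcf : ∏ l ∈ Finset.Icc (1 - (n : ℤ)) n, cfac ((γ : ℂ) ^ 2 / 4) k l =
        ∏ l ∈ Finset.Icc (1 - (n : ℤ)) n, ((k : ℂ) * ((γ : ℂ) ^ 2 / 4) + l) :=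
      Finset.prod_congr rfl fun l _ => by simp [cfac, hk]
    have hne : ∀ l : ℤ, (k : ℂ) * ((γ : ℂ) ^ 2 / 4) + l ≠ 0 := fun l hl => hk (aux_ne hirr k l hl).1
    rw [hcf, gamma_shift n _ fun l _ => hne l, mul_div_cancel_right₀ _
      (Finset.prod_ne_zero_iff.mpr fun l _ => hne l)]
    have hc : ContinuousAt (fun s : ℂ =>
        Complex.Gamma (1 + ((k : ℂ) * ((γ : ℂ) ^ 2 / 4) + s) - n)) 0 := by
      refine ContinuousAt.comp (g := Complex.Gamma)
        (f := fun s : ℂ => 1 + ((k : ℂ) * ((γ : ℂ) ^ 2 / 4) + s) - n) ?_ (by fun_prop)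
      have := gamma_cont hirr k (1 - n) (by intro; omega)
      convert this using 1
      push_cast; ring
    have := hc.tendsto.mono_left (nhdsWithin_le_nhds (s := {0}ᶜ))
    simpa only [add_zero] using this

lemma factor2_tendsto {γ : ℝ} (hirr : Irrational (γ ^ 2)) (n : ℕ) (k : ℤ) (hk : k ≠ 0) :
    Tendsto (fun s : ℂ => Complex.Gamma (1 + ((k : ℂ) * ((γ : ℂ) ^ 2 / 4) - s) + n))
      (nhdsWithin 0 {0}ᶜ)
      (nhds (Complex.Gamma (1 + (k : ℂ) * ((γ : ℂ) ^ 2 / 4) - n) *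
        ∏ l ∈ Finset.Icc (1 - (n : ℤ)) n, cfac ((γ : ℂ) ^ 2 / 4) k l)) := by
  have hcf : ∏ l ∈ Finset.Icc (1 - (n : ℤ)) n, cfac ((γ : ℂ) ^ 2 / 4) k l =
      ∏ l ∈ Finset.Icc (1 - (n : ℤ)) n, ((k : ℂ) * ((γ : ℂ) ^ 2 / 4) + l) :=
    Finset.prod_congr rfl fun l _ => by simp [cfac, hk]
  have hne : ∀ l : ℤ, (k : ℂ) * ((γ : ℂ) ^ 2 / 4) + l ≠ 0 := fun l hl => hk (aux_ne hirr k l hl).1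
  rw [hcf, ← gamma_shift n _ fun l _ => hne l]
  have hc : ContinuousAt (fun s : ℂ =>
      Complex.Gamma (1 + ((k : ℂ) * ((γ : ℂ) ^ 2 / 4) - s) + n)) 0 := by
    refine ContinuousAt.comp (g := Complex.Gamma)
      (f := fun s : ℂ => 1 + ((k : ℂ) * ((γ : ℂ) ^ 2 / 4) - s) + n) ?_ (by fun_prop)
    have := gamma_cont hirr k (1 + n) (by intro; omega)
    convert this using 1
    push_cast; ring
  have := hc.tendsto.mono_left (nhdsWithin_le_nhds (s := {0}ᶜ))
  simpa only [sub_zero] using this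

/-- The Gamma-residue computation at the core of Lemma 7.13 (lem:residue): as
`P → P_{m,n}` with `P ≠ P_{m,n}`, one has
`(P − P_{m,n})·f(P) → (1/(2P_{m,n}))·R_{γ,m,n}(−Nγ)·f(P_{−m,n})`, i.e. `f` has a simple
pole at `P_{m,n}` with the indicated residue. -/
theorem gammaProd_residue {γ : ℝ} (hγ : γ ∈ Set.Ioo (0 : ℝ) 2) (hirr : Irrational (γ ^ 2))
    {N : ℕ} (hN : 1 ≤ N) (hNγ : (N : ℝ) * γ ^ 2 < 4)
    {m n : ℤ} (hm : 1 ≤ m) (hmN : m ≤ (N : ℤ)) (hn : 1 ≤ n) :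
    Tendsto (fun P : ℂ => (P - Pmn γ m n) * gammaProd N γ P)
      (nhdsWithin (Pmn γ m n) {Pmn γ m n}ᶜ)
      (nhds ((1 / (2 * Pmn γ m n)) * Rcoef γ (-(N : ℂ) * (γ : ℂ)) m n *
        gammaProd N γ (Pmn γ (-m) n))) := by
  have hγ0 : γ ≠ 0 := ne_of_gt hγ.1
  have hg : (γ : ℂ) ≠ 0 := by exact_mod_cast hγ0
  have hI := Complex.I_ne_zero
  rw [Rcoef_eq hγ0 hirr N m n hm hmN hn]
  obtain ⟨n, rfl⟩ := Int.eq_ofNat_of_zero_le (by omega : 0 ≤ n)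
  obtain ⟨m, rfl⟩ := Int.eq_ofNat_of_zero_le (by omega : 0 ≤ m)
  have hn' : 1 ≤ n := by omega
  rw [← telescope (fun k => ∏ l ∈ Finset.Icc (1 - (n : ℤ)) n, cfac ((γ : ℂ) ^ 2 / 4) k l)
    (fun k => Finset.prod_ne_zero_iff.mpr fun l _ => cfac_ne hirr k l) m hm N]
  have hs : Tendsto (fun P : ℂ => Complex.I * γ * (P - Pmn γ m n) / 2)
      (nhdsWithin (Pmn γ m n) {Pmn γ m n}ᶜ) (nhdsWithin 0 {0}ᶜ) := by
    refine tendsto_nhdsWithin_iff.mpr ⟨?_, ?_⟩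
    · have : ContinuousAt (fun P : ℂ => Complex.I * γ * (P - Pmn γ m n) / 2) (Pmn γ m n) := by
        fun_prop
      have := this.tendsto.mono_left (nhdsWithin_le_nhds (s := {Pmn γ m n}ᶜ))
      simpa using this
    · filter_upwards [self_mem_nhdsWithin] with P hP
      have : P - Pmn γ m n ≠ 0 := sub_ne_zero.mpr hP
      simp [hI, hg, this]
  have hlim := tendsto_finsetProd (Finset.Icc 1 N) (fun j hj =>
    (factor_tendsto hirr n hn' ((j : ℤ) - m)).mul
      (factor2_tendsto hirr n ((j : ℤ) + m) (by have := (Finset.mem_Icc.mp hj).1; omega)))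
  have hlim2 := (hlim.comp hs).const_mul (2 / (Complex.I * γ))
  convert hlim2 using 2
  · rename_i P
    simp only [Function.comp]
    have e : ∀ j : ℕ, ((j : ℤ) - m = 0) ↔ m = j := by intro j; omega
    simp only [e, mul_assoc, Finset.prod_mul_distrib, Finset.prod_ite_eq, Finset.mem_Icc]
    rw [if_pos (by omega), gammaProd, Finset.prod_mul_distrib]
    rw [← mul_assoc, ← mul_assoc, ← mul_assoc]
    congr 1
    · congr 1
      · field_simp
      · refine Finset.prod_congr rfl fun j _ => ?_
        congr 1
        simp only [Pmn]
        push_cast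
        field_simp
        ring_nf
        simp only [Complex.I_sq]
        ring
    · refine Finset.prod_congr rfl fun j _ => ?_
      congr 1
      simp only [Pmn]
      push_cast
      field_simp
      ring_nf
      simp only [Complex.I_sq]
      ring
  · rw [mul_assoc]
    congr 1
    rw [gammaProd, ← Finset.prod_mul_distrib]
    refine Finset.prod_congr rfl fun j _ => ?_
    have e1 : (1 + (j : ℂ) * (γ : ℂ) ^ 2 / 4 + Complex.I * (γ : ℂ) * Pmn γ (-(m : ℤ)) n / 2) =
      1 + (((j : ℤ) + m : ℤ) : ℂ) * ((γ : ℂ) ^ 2 / 4) - n := by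
      simp only [Pmn]
      push_cast
      field_simp
      ring_nf
      simp only [Complex.I_sq]
      ring
    have e2 : (1 + (j : ℂ) * (γ : ℂ) ^ 2 / 4 - Complex.I * (γ : ℂ) * Pmn γ (-(m : ℤ)) n / 2) =
      1 + (((j : ℤ) - m : ℤ) : ℂ) * ((γ : ℂ) ^ 2 / 4) + n := by
      simp only [Pmn]
      push_cast
      field_simp
      ring_nf
      simp only [Complex.I_sq]
      ring
    rw [e1, e2]
    ring
end

section
/- Say that f : ℂ → ℂ satisfies Property (R) if there are complex coefficients (a_k)_{k≥0} with Σ_{k≥0}|a_k| < ∞ and f(w) = Σ_{k≥0} a_k w^k for all complex w with |w| ≤ 1. Let A, B, C ∈ ℂ with C ∉ ℤ, Re(C − A − B) ∈ (0,1), and assume none of A, B, C−A, C−B is an integer. Let X ∈ {0, 1 − C} and let g̃ satisfy Property (R). Then for every a ∈ ℂ there exists exactly one function f satisfying Property (R) such that f(1) = a and such that the function u(w) := exp(X·Log w)·f(w) (principal branch of w^X) satisfies the inhomogeneous hypergeometric equation w(1−w)·u''(w) + (C − (1+A+B)w)·u'(w) − A·B·u(w) = exp(X·Log w)·g̃(w)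 for every w in the slit disc {w ∈ ℂ : |w| < 1} ∖ (−1, 0]. -/
open Complex Metric Set

/-- Property (R): `f` is given on the closed unit disc by a power series with absolutely
summable coefficients. -/
def PropertyR (f : ℂ → ℂ) : Prop :=
  ∃ a : ℕ → ℂ, Summable (fun k => ‖a k‖) ∧
    ∀ w : ℂ, ‖w‖ ≤ 1 → HasSum (fun k => a k * w ^ k) (f w)

lemma raabe_aux (a : ℕ → ℂ) (e : ℕ → ℝ) (s : ℝ) (hs : 0 < s) (he : Summable e) (he0 : ∀ k, 0 ≤ e k)
    (h : ∀ᶠ k : ℕ in Filter.atTop, (k : ℝ) * ‖a (k+1)‖ ≤ (k - 1 - s) * ‖a k‖ + e k) :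
    Summable (fun k => ‖a k‖) := by
  obtain ⟨K, hK⟩ := Filter.eventually_atTop.1 (h.and (Filter.eventually_ge_atTop 1))
  have hK1 : 1 ≤ K := (hK K le_rfl).2
  rw [← summable_nat_add_iff K]
  have key : ∀ n : ℕ, s * ∑ i ∈ Finset.range n, ‖a (i + K)‖ + ((n + K : ℕ) - 1 : ℝ) * ‖a (n + K)‖
      ≤ (K - 1) * ‖a K‖ + ∑ i ∈ Finset.range n, e (i + K) := by
    intro n
    induction n with
    | zero => simp
    | succ n ih =>
      rw [Finset.sum_range_succ, Finset.sum_range_succ]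
      have := (hK (n + K) (by omega)).1
      rw [show n + 1 + K = n + K + 1 by ring]
      push_cast at *
      linarith
  have hE : ∀ n, ∑ i ∈ Finset.range n, e (i + K) ≤ ∑' i, e (i + K) := fun n =>
    ((summable_nat_add_iff K).2 he).sum_le_tsum _ (fun i _ => he0 _)
  refine summable_of_sum_range_le (c := ((K - 1) * ‖a K‖ + ∑' i, e (i + K)) / s) (fun _ => norm_nonneg _) ?_
  intro n
  rw [le_div_iff₀ hs]
  have h1 : 0 ≤ ((n + K : ℕ) - 1 : ℝ) * ‖a (n + K)‖ := by
    apply mul_nonneg _ (norm_nonneg _)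
    have : (1:ℝ) ≤ ((n + K : ℕ) : ℝ) := by exact_mod_cast (by omega)
    linarith
  linarith [key n, hE n]

lemma norm_nat_add_le (A : ℂ) (d : ℝ) (hd : 0 < d) :
    ∀ᶠ k : ℕ in Filter.atTop, ‖(k : ℂ) + A‖ ≤ k + A.re + d := by
  obtain ⟨N, hN⟩ := exists_nat_gt (|A.re| + A.im ^ 2 / d)
  filter_upwards [Filter.eventually_ge_atTop N] with k hk
  have hk' : (N : ℝ) ≤ k := by exact_mod_cast hk
  have h1 : -|A.re| ≤ A.re := neg_abs_le _
  have h2 : A.im ^ 2 / d ≤ k + A.re := by linarith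
  have h3 : 0 ≤ A.im ^ 2 / d := by positivity
  have h4 : A.im ^ 2 ≤ (k + A.re) * d := by rwa [div_le_iff₀ hd] at h2
  rw [Complex.norm_eq_sqrt_sq_add_sq]
  apply Real.sqrt_le_iff.2 ⟨by linarith, ?_⟩
  simp
  nlinarith

lemma ratio_bound (A B C : ℂ) (h : 0 < (C - A - B).re) :
    ∀ᶠ k : ℕ in Filter.atTop, (k : ℝ) * (‖(k : ℂ) + A‖ * ‖(k : ℂ) + B‖) ≤
      (k - 1 - (C - A - B).re / 4) * ((k + 1) * ‖(k : ℂ) + C‖) := by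
  set σ := (C - A - B).re with hσ
  have hσ' : σ = C.re - A.re - B.re := by simp [hσ]
  have hd : 0 < σ / 4 := by positivity
  obtain ⟨N, hN⟩ := exists_nat_gt (|A.re| + |B.re| + |C.re| + σ + 2 +
    (|1 + (σ/4) * C.re + σ/4| + |(A.re + σ/4) * (B.re + σ/4)| + |(1 + σ/4) * C.re|) / (σ/4))
  filter_upwards [norm_nat_add_le A _ hd, norm_nat_add_le B _ hd, Filter.eventually_ge_atTop N] with k h1 h2 hk
  have hk' : (N : ℝ) ≤ k := by exact_mod_cast hk
  have hA := neg_abs_le A.re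
  have hB := neg_abs_le B.re
  have hC := neg_abs_le C.re
  have hA0 := abs_nonneg A.re
  have hB0 := abs_nonneg B.re
  have hC0 := abs_nonneg C.re
  have hq : 0 ≤ (|1 + (σ/4) * C.re + σ/4| + |(A.re + σ/4) * (B.re + σ/4)| + |(1 + σ/4) * C.re|) / (σ/4) := by positivity
  have h3 : (k : ℝ) + C.re ≤ ‖(k : ℂ) + C‖ := by
    have := Complex.re_le_norm ((k : ℂ) + C); simpa using this
  have hle : (|1 + (σ/4) * C.re + σ/4| + |(A.re + σ/4) * (B.re + σ/4)| + |(1 + σ/4) * C.re|) ≤ k * (σ/4) := by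
    rw [← div_le_iff₀ hd]; linarith
  have hk1 : (1 : ℝ) ≤ k := by linarith
  calc (k : ℝ) * (‖(k : ℂ) + A‖ * ‖(k : ℂ) + B‖) ≤ k * ((k + A.re + σ/4) * (k + B.re + σ/4)) := by
        gcongr
        linarith
    _ ≤ (k - 1 - σ/4) * ((k + 1) * (k + C.re)) := by
        have e1 := abs_le.1 (le_refl |1 + (σ/4) * C.re + σ/4|)
        have e2 := abs_le.1 (le_refl |(A.re + σ/4) * (B.re + σ/4)|)
        have e3 := abs_le.1 (le_refl |(1 + σ/4) * C.re|)
        have e4 := abs_nonneg ((1 + σ/4) * C.re)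
        have e5 := abs_nonneg ((A.re + σ/4) * (B.re + σ/4))
        have e6 := abs_nonneg (1 + (σ/4) * C.re + σ/4)
        have hid : (k - 1 - σ/4) * ((k + 1) * (k + C.re)) - k * ((k + A.re + σ/4) * (k + B.re + σ/4))
          = k * (k * (σ/4) - (1 + (σ/4) * C.re + σ/4) - (A.re + σ/4) * (B.re + σ/4)) - (1 + σ/4) * C.re := by
          rw [hσ']; ring
        have hm : |(1 + σ/4) * C.re| ≤ k * (σ/4) - (1 + (σ/4) * C.re + σ/4) - (A.re + σ/4) * (B.re + σ/4) := by
          linarith [e1.2, e2.2]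
        have hm2 := mul_le_mul hk1 hm e4 (by linarith)
        linarith [e3.2]
    _ ≤ _ := by
        gcongr
        linarith

/-- Sequence satisfying the hypergeometric recursion is summable -/
lemma rec_summable (A B C : ℂ) (h : 0 < (C - A - B).re) (a g : ℕ → ℂ) (hg : Summable fun k => ‖g k‖)
    (hrec : ∀ k : ℕ, ((k : ℂ) + 1) * (k + C) * a (k+1) = (k + A) * (k + B) * a k + g k) :
    Summable (fun k => ‖a k‖) := by
  refine raabe_aux a (fun k => ‖g k‖) _ (by positivity : 0 < (C - A - B).re / 4) hg (fun _ => norm_nonneg _) ?_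
  obtain ⟨N, hN⟩ := exists_nat_gt (1 + |C.re|)
  filter_upwards [ratio_bound A B C h, Filter.eventually_ge_atTop N] with k h1 hk
  have hk' : (N : ℝ) ≤ k := by exact_mod_cast hk
  have hC := neg_abs_le C.re
  have h3 : (k : ℝ) + C.re ≤ ‖(k : ℂ) + C‖ := by
    have := Complex.re_le_norm ((k : ℂ) + C); simpa using this
  have h4 : 1 ≤ ‖(k : ℂ) + C‖ := by linarith
  have h5 : ‖((k : ℂ) + 1) * (k + C) * a (k+1)‖ ≤ ‖(k : ℂ) + A‖ * ‖(k : ℂ) + B‖ * ‖a k‖ + ‖g k‖ := by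
    rw [hrec]
    refine (norm_add_le _ _).trans ?_
    simp
  have h6 : ‖(k : ℂ) + 1‖ = k + 1 := by
    have : (k : ℂ) + 1 = ((k + 1 : ℕ) : ℂ) := by push_cast; rfl
    rw [this, Complex.norm_natCast]; push_cast; rfl
  rw [norm_mul, norm_mul, h6] at h5
  have hk0 : (0:ℝ) ≤ k := by positivity
  have hpos : 0 < ((k:ℝ) + 1) * ‖(k : ℂ) + C‖ := by positivity
  refine le_of_mul_le_mul_left ?_ hpos
  calc ((k:ℝ) + 1) * ‖(k : ℂ) + C‖ * (k * ‖a (k+1)‖) = k * (((k:ℝ) + 1) * ‖(k : ℂ) + C‖ * ‖a (k+1)‖) := by ring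
    _ ≤ k * (‖(k : ℂ) + A‖ * ‖(k : ℂ) + B‖ * ‖a k‖ + ‖g k‖) := by gcongr
    _ = k * (‖(k : ℂ) + A‖ * ‖(k : ℂ) + B‖) * ‖a k‖ + k * 1 * ‖g k‖ := by ring
    _ ≤ (k - 1 - (C - A - B).re / 4) * ((k + 1) * ‖(k : ℂ) + C‖) * ‖a k‖ + (k + 1) * ‖(k : ℂ) + C‖ * ‖g k‖ := by
        gcongr
        linarith
    _ = _ := by ring

noncomputable def hyp (A B C : ℂ) (k : ℕ) : ℂ :=
  ∏ i ∈ Finset.range k, ((i + A) * (i + B) / ((i + 1) * (i + C)))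

lemma nat_add_ne {C : ℂ} (hC : ∀ k : ℤ, C ≠ (k : ℂ)) (n : ℕ) : (n : ℂ) + C ≠ 0 := by
  intro h
  apply hC (-n)
  push_cast
  linear_combination h

lemma hyp_rec (A B C : ℂ) (hC : ∀ k : ℤ, C ≠ (k : ℂ)) (k : ℕ) :
    ((k : ℂ) + 1) * (k + C) * hyp A B C (k+1) = (k + A) * (k + B) * hyp A B C k := by
  rw [hyp, Finset.prod_range_succ, ← hyp]
  have := nat_add_ne hC k
  have h2 : (k : ℂ) + 1 ≠ 0 := Nat.cast_add_one_ne_zero k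
  field_simp

lemma hyp_summable (A B C : ℂ) (hC : ∀ k : ℤ, C ≠ (k : ℂ)) (h : 0 < (C - A - B).re) :
    Summable (fun k => ‖hyp A B C k‖) :=
  rec_summable A B C h _ (fun _ => 0) (by simp) (by simpa using hyp_rec A B C hC)

lemma hyp_succ_C (A B C : ℂ) (hC : ∀ k : ℤ, C ≠ (k : ℂ)) (k : ℕ) :
    (k + C) * hyp A B (C + 1) k = C * hyp A B C k := by
  have hC1 : ∀ k : ℤ, C + 1 ≠ (k : ℂ) := fun k h => hC (k - 1) (by push_cast; linear_combination h)
  induction k with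
  | zero => simp [hyp]
  | succ k ih =>
    have h1 := hyp_rec A B C hC k
    have h2 := hyp_rec A B (C+1) hC1 k
    have h3 := nat_add_ne hC k
    have h5 := nat_add_ne hC1 k
    have h4 : (k : ℂ) + 1 ≠ 0 := Nat.cast_add_one_ne_zero k
    apply mul_left_cancel₀ (mul_ne_zero h4 h3)
    push_cast
    linear_combination (k + C) * h2 - C * h1 + (k + A) * (k + B) * ih

lemma lim_zero (h : ℕ → ℂ) (hs : Summable fun k => ‖h k‖) (L : ℂ)
    (hL : Filter.Tendsto (fun k : ℕ => (k : ℂ) * h k) Filter.atTop (nhds L)) : L = 0 := by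
  by_contra hne
  have hpos : 0 < ‖L‖ := norm_pos_iff.2 hne
  have h1 := hL.norm.eventually (lt_mem_nhds (half_lt_self hpos))
  apply Real.not_summable_one_div_natCast
  refine summable_of_isBigO_nat hs ?_
  refine Asymptotics.IsBigO.of_bound (2 / ‖L‖) ?_
  filter_upwards [h1, Filter.eventually_gt_atTop 0] with k hk hk0
  have hk0' : (0:ℝ) < k := by exact_mod_cast hk0
  simp only [norm_mul, Complex.norm_natCast] at hk
  simp only [norm_div, norm_one, norm_norm, RCLike.norm_natCast]
  rw [div_le_iff₀ hk0', div_mul_eq_mul_div, div_mul_eq_mul_div, le_div_iff₀ hpos]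
  linarith

lemma contig (A B C : ℂ) (hC : ∀ k : ℤ, C ≠ (k : ℂ)) (h : 0 < (C - A - B).re) :
    (C - A - B) * C * ∑' k, hyp A B C k = (C - A) * (C - B) * ∑' k, hyp A B (C+1) k := by
  have hC1 : ∀ k : ℤ, C + 1 ≠ (k : ℂ) := fun k h => hC (k - 1) (by push_cast; linear_combination h)
  have s1 := hyp_summable A B C hC h
  have s2 := hyp_summable A B (C+1) hC1 (by simp at h ⊢; linarith)
  have e1 := (s1.of_norm.hasSum.mul_left ((C - A - B) * C)).sub (s2.of_norm.hasSum.mul_left ((C - A) * (C - B)))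
  have e2 := e1.tendsto_sum_nat
  have e3 : ∀ n, ∑ k ∈ Finset.range n, ((C - A - B) * C * hyp A B C k - (C - A) * (C - B) * hyp A B (C+1) k)
     = - C * (n * hyp A B C n) := by
    intro n
    induction n with
    | zero => simp
    | succ k ih =>
      rw [Finset.sum_range_succ, ih]
      have h1 := hyp_rec A B C hC k
      have h2 := hyp_succ_C A B C hC k
      apply mul_left_cancel₀ (nat_add_ne hC k)
      push_cast
      linear_combination C * h1 - (C - A) * (C - B) * h2
  simp only [e3] at e2
  have hC0 : C ≠ 0 := by simpa using hC 0
  have e4 := e2.const_mul (-C⁻¹)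
  have e5 := lim_zero _ s1 _ (e4.congr (fun n => by field_simp))
  have : -C⁻¹ ≠ 0 := by simpa using hC0
  have := (mul_eq_zero.1 e5).resolve_left this
  linear_combination this

lemma hyp_sum_large (A B C : ℂ) (hC : ∀ k : ℤ, C ≠ (k : ℂ)) (h : 0 < (C - A - B).re) :
    ∃ N : ℕ, ∑' k, hyp A B (C + N) k ≠ 0 := by
  have hCN : ∀ N : ℕ, ∀ k : ℤ, C + N ≠ (k : ℂ) := fun N k h => hC (k - N) (by push_cast; linear_combination h)
  obtain ⟨M, hM⟩ := exists_nat_gt (|C.re|)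
  have hM' := neg_abs_le C.re
  have hlim : Filter.Tendsto (fun N : ℕ => ∑' k, hyp A B (C + N) k) Filter.atTop
      (nhds (∑' k, if k = 0 then (1 : ℂ) else 0)) := by
    refine tendsto_tsum_of_dominated_convergence
      (hyp_summable A B (C + M) (hCN M) (by simp at h ⊢; linarith [(Nat.cast_nonneg M : (0:ℝ) ≤ M)])) ?_ ?_
    · intro k
      rcases k with _ | k
      · simp [hyp]
      · have hz : ((if k + 1 = 0 then (1 : ℂ) else 0)) = ∏ i ∈ Finset.range (k+1), (0 : ℂ) := by simp
        rw [hz]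
        unfold hyp
        refine tendsto_finsetProd _ fun i _ => ?_
        have h1 : Filter.Tendsto (fun N : ℕ => ‖(i : ℂ) + (C + N)‖) Filter.atTop Filter.atTop := by
          refine Filter.tendsto_atTop_mono (f := fun N : ℕ => (N : ℝ) + (i + C.re)) ?_
            (Filter.tendsto_atTop_add_const_right _ _ tendsto_natCast_atTop_atTop)
          intro N
          refine le_trans (le_of_eq ?_) (Complex.re_le_norm _)
          simp
          ring
        have h2 := Filter.Tendsto.comp Filter.tendsto_inv₀_cobounded (tendsto_norm_atTop_iff_cobounded.1 h1)
        have h3 := h2.const_mul ((i + A) * (i + B) / (i + 1) : ℂ)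
        rw [mul_zero] at h3
        refine h3.congr fun N => ?_
        simp only [Function.comp]
        rw [← div_eq_mul_inv, div_div]
    · filter_upwards [Filter.eventually_ge_atTop M] with N hN k
      have hN' : (M : ℝ) ≤ N := by exact_mod_cast hN
      unfold hyp
      rw [norm_prod, norm_prod]
      refine Finset.prod_le_prod (fun _ _ => norm_nonneg _) fun i _ => ?_
      rw [norm_div, norm_div, norm_mul ((i:ℂ)+1), norm_mul ((i:ℂ)+1)]
      have hp : 0 < ‖(i : ℂ) + (C + M)‖ := norm_pos_iff.2 (nat_add_ne (hCN M) i)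
      have hp1 : 0 < ‖(i : ℂ) + 1‖ := norm_pos_iff.2 (Nat.cast_add_one_ne_zero i)
      gcongr 2
      rw [Complex.norm_eq_sqrt_sq_add_sq, Complex.norm_eq_sqrt_sq_add_sq]
      apply Real.sqrt_le_sqrt
      simp
      have : (0:ℝ) ≤ i := by positivity
      gcongr
      linarith
  rw [tsum_ite_eq] at hlim
  exact (hlim.eventually_ne one_ne_zero).exists

lemma hyp_sum_ne (A B C : ℂ) (hC : ∀ k : ℤ, C ≠ (k : ℂ)) (h : 0 < (C - A - B).re)
    (hCA : ∀ k : ℤ, C - A ≠ (k : ℂ)) (hCB : ∀ k : ℤ, C - B ≠ (k : ℂ)) :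
    ∑' k, hyp A B C k ≠ 0 := by
  have hCN : ∀ N : ℕ, ∀ k : ℤ, C + N ≠ (k : ℂ) := fun N k h => hC (k - N) (by push_cast; linear_combination h)
  obtain ⟨N, hN⟩ := hyp_sum_large A B C hC h
  induction N with
  | zero => simpa using hN
  | succ N ih =>
    apply ih
    intro h0
    have := contig A B (C + N) (hCN N) (by simp at h ⊢; linarith [(Nat.cast_nonneg N : (0:ℝ) ≤ N)])
    rw [h0, mul_zero] at this
    push_cast at hN
    rw [← add_assoc] at hN
    have h1 := mul_eq_zero.1 ((mul_eq_zero.1 this.symm).resolve_right hN)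
    rcases h1 with h1 | h1
    · exact hCA (-N) (by push_cast; linear_combination h1)
    · exact hCB (-N) (by push_cast; linear_combination h1)

def PSer (c : ℕ → ℂ) (f : ℂ → ℂ) : Prop := ∀ w : ℂ, ‖w‖ < 1 → HasSum (fun k => c k * w ^ k) (f w)

lemma hasSum_cast {f g : ℕ → ℂ} {a b : ℂ} (h : HasSum f a) (h1 : ∀ k, g k = f k) (h2 : b = a) :
    HasSum g b := by
  obtain rfl : g = f := funext h1
  rw [h2]; exact h

lemma PSer.fps {c : ℕ → ℂ} {f : ℂ → ℂ} (h : PSer c f) :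
    HasFPowerSeriesOnBall f (FormalMultilinearSeries.ofScalars ℂ c) 0 1 := by
  refine ⟨?_, one_pos, ?_⟩
  · refine ENNReal.le_of_forall_nnreal_lt fun r hr => ?_
    have hr1 : (r : ℝ) < 1 := by exact_mod_cast hr
    have hs := (h (r : ℂ) (by simpa using hr1)).summable.tendsto_atTop_zero.norm
    refine FormalMultilinearSeries.le_radius_of_tendsto _ (l := 0) ?_
    simpa [FormalMultilinearSeries.ofScalars_norm] using hs
  · intro y hy
    have hy' : ‖y‖ < 1 := by
      simpa [edist_zero_right, ← ofReal_norm] using hy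
    simpa [FormalMultilinearSeries.ofScalars_apply_eq, mul_comm] using h y hy'

lemma PSer.deriv {c : ℕ → ℂ} {f : ℂ → ℂ} (h : PSer c f) :
    PSer (fun k => (k + 1) * c (k + 1)) (deriv f) := by
  intro w hw
  have h1 := h.fps.fderiv
  have hw' : w ∈ Metric.eball (0:ℂ) 1 := by
    simpa [edist_zero_right, ← ofReal_norm] using hw
  have h2 := h1.hasSum hw'
  have h3 := h2.mapL (ContinuousLinearMap.apply ℂ ℂ (1:ℂ))
  simp only [zero_add, ContinuousLinearMap.apply_apply, fderiv_apply_one_eq_deriv] at h3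
  refine hasSum_cast h3 (fun k => ?_) rfl
  rw [FormalMultilinearSeries.apply_eq_pow_smul_coeff, _root_.smul_apply,
    FormalMultilinearSeries.derivSeries_coeff_one, FormalMultilinearSeries.coeff_ofScalars]
  simp
  ring

lemma PSer.diff {c : ℕ → ℂ} {f : ℂ → ℂ} (h : PSer c f) {w : ℂ} (hw : ‖w‖ < 1) :
    DifferentiableAt ℂ f w := by
  have hw' : w ∈ Metric.eball (0:ℂ) 1 := by
    simpa [edist_zero_right, ← ofReal_norm] using hw
  exact (h.fps.analyticAt_of_mem hw').differentiableAt

lemma PSer.xmul {c : ℕ → ℂ} {f : ℂ → ℂ} (h : PSer c f) :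
    PSer (fun k => if k = 0 then 0 else c (k - 1)) (fun w => w * f w) := by
  intro w hw
  rw [← hasSum_nat_add_iff' 1]
  simpa [pow_succ, mul_comm, mul_assoc, mul_left_comm] using (h w hw).mul_left w

lemma PSer.op {c : ℕ → ℂ} {f : ℂ → ℂ} (h : PSer c f) (A B C : ℂ) :
    PSer (fun k => (k + 1) * (k + C) * c (k+1) - (k + A) * (k + B) * c k)
      (fun w => w * (1 - w) * _root_.deriv (_root_.deriv f) w +
        (C - (1 + A + B) * w) * _root_.deriv f w - A * B * f w) := by
  intro w hw
  have h1 := h.deriv w hw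
  have h1x := h.deriv.xmul w hw
  have h2 := h.deriv.deriv.xmul w hw
  have h2x := h.deriv.deriv.xmul.xmul w hw
  have := ((h2.sub h2x).add ((h1.mul_left C).sub (h1x.mul_left (1 + A + B)))).sub ((h w hw).mul_left (A * B))
  refine hasSum_cast this (fun k => ?_) ?_
  · rcases k with _ | _ | k
    · simp
    · simp; ring
    · simp; ring
  · simp only []; ring

lemma PSer.unique {c d : ℕ → ℂ} {f g : ℂ → ℂ} (hf : PSer c f) (hg : PSer d g)
    (h : ∀ w : ℂ, ‖w‖ < 1 → ¬(w.im = 0 ∧ -1 < w.re ∧ w.re ≤ 0) → f w = g w) : c = d := by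
  have hx : ∃ᶠ w in nhdsWithin (0:ℂ) {0}ᶜ, f w = g w := by
    have ht : Filter.Tendsto (fun n : ℕ => (((1:ℝ) / ((n:ℝ) + 1 + 1) : ℝ) : ℂ)) Filter.atTop (nhdsWithin (0:ℂ) {0}ᶜ) := by
      refine tendsto_nhdsWithin_iff.2 ⟨?_, ?_⟩
      · have := (tendsto_one_div_add_atTop_nhds_zero_nat (𝕜 := ℝ)).comp (Filter.tendsto_add_atTop_nat 1)
        have h2 := (Complex.continuous_ofReal.tendsto 0).comp this
        simpa [Function.comp_def] using h2
      · refine Filter.Eventually.of_forall fun n => ?_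
        have : (0:ℝ) < 1 / ((n:ℝ) + 1 + 1) := by positivity
        simp only [mem_compl_iff, mem_singleton_iff]
        exact_mod_cast this.ne'
    refine ht.frequently (Filter.Eventually.of_forall fun n => ?_).frequently
    have h0 : (0:ℝ) < 1 / ((n:ℝ) + 1 + 1) := by positivity
    have h1 : 1 / ((n:ℝ) + 1 + 1) < 1 := by
      rw [div_lt_one (by positivity)]
      have : (0:ℝ) ≤ n := by positivity
      linarith
    refine h _ ?_ ?_
    · rw [Complex.norm_real, Real.norm_of_nonneg h0.le]; exact h1
    · rintro ⟨-, -, h3⟩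
      rw [Complex.ofReal_re] at h3
      linarith
  have he := (AnalyticAt.frequently_eq_iff_eventually_eq hf.fps.analyticAt hg.fps.analyticAt).1 hx
  have := hf.fps.hasFPowerSeriesAt.eq_formalMultilinearSeries_of_eventually hg.fps.hasFPowerSeriesAt he
  exact FormalMultilinearSeries.ofScalars_series_injective ℂ ℂ this

lemma mem_slit {w : ℂ} (hw : ‖w‖ < 1) (h : ¬(w.im = 0 ∧ -1 < w.re ∧ w.re ≤ 0)) : w ∈ Complex.slitPlane := by
  rw [Complex.mem_slitPlane_iff]
  by_contra hc
  push Not at hc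
  refine h ⟨hc.2, ?_, hc.1⟩
  have := abs_le.1 (Complex.abs_re_le_norm w)
  linarith

lemma ode_conj {c : ℕ → ℂ} {f : ℂ → ℂ} (hf : PSer c f) (A B C X : ℂ) (hX : X = 0 ∨ X = 1 - C)
    {w : ℂ} (hw : ‖w‖ < 1) (h : ¬(w.im = 0 ∧ -1 < w.re ∧ w.re ≤ 0)) :
    w * (1 - w) *
              deriv (deriv (fun z : ℂ => Complex.exp (X * Complex.log z) * f z)) w +
            (C - (1 + A + B) * w) *
              deriv (fun z : ℂ => Complex.exp (X * Complex.log z) * f z) w -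
            A * B * (Complex.exp (X * Complex.log w) * f w) =
    Complex.exp (X * Complex.log w) * (w * (1 - w) * deriv (deriv f) w +
        ((C + 2 * X) - (1 + (A + X) + (B + X)) * w) * deriv f w - (A + X) * (B + X) * f w) := by
  have hs := mem_slit hw h
  have hw0 : w ≠ 0 := Complex.slitPlane_ne_zero hs
  have hE : ∀ z ∈ Complex.slitPlane, HasDerivAt (fun z : ℂ => Complex.exp (X * Complex.log z))
      (Complex.exp (X * Complex.log z) * (X * z⁻¹)) z := fun z hz =>
    ((Complex.hasDerivAt_log hz).const_mul X).cexp
  have h1 : ∀ z ∈ Complex.slitPlane, ‖z‖ < 1 → HasDerivAt (fun z : ℂ => Complex.exp (X * Complex.log z) * f z)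
      (Complex.exp (X * Complex.log z) * (X * z⁻¹) * f z + Complex.exp (X * Complex.log z) * deriv f z) z :=
    fun z hz hz1 => (hE z hz).mul (hf.diff hz1).hasDerivAt
  have hev : deriv (fun z : ℂ => Complex.exp (X * Complex.log z) * f z) =ᶠ[nhds w]
      fun z => Complex.exp (X * Complex.log z) * (X * z⁻¹) * f z + Complex.exp (X * Complex.log z) * deriv f z := by
    filter_upwards [Complex.isOpen_slitPlane.mem_nhds hs,
      (isOpen_lt continuous_norm continuous_const).mem_nhds hw] with z hz hz1
    exact (h1 z hz hz1).deriv
  have h2 := (((hE w hs).mul ((hasDerivAt_inv hw0).const_mul X)).mul (hf.diff hw).hasDerivAt).add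
    ((hE w hs).mul (hf.deriv.diff hw).hasDerivAt)
  rw [hev.deriv_eq, (h1 w hs hw).deriv]
  have h3 := h2.deriv
  simp only [Pi.mul_def, Pi.add_def] at h3
  rw [h3]
  have hX' : X * (X - 1 + C) = 0 := by
    rcases hX with rfl | rfl <;> ring
  field_simp
  linear_combination (f w) * hX'

/-- particular solution -/
noncomputable def part (A B C : ℂ) (g : ℕ → ℂ) (a0 : ℂ) : ℕ → ℂ
  | 0 => a0
  | k + 1 => ((k + A) * (k + B) * part A B C g a0 k + g k) / ((k + 1) * (k + C))

lemma part_rec (A B C : ℂ) (hC : ∀ k : ℤ, C ≠ (k : ℂ)) (g : ℕ → ℂ) (a0 : ℂ) (k : ℕ) :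
    ((k : ℂ) + 1) * (k + C) * part A B C g a0 (k+1) = (k + A) * (k + B) * part A B C g a0 k + g k := by
  rw [part]
  have := nat_add_ne hC k
  have h2 : (k : ℂ) + 1 ≠ 0 := Nat.cast_add_one_ne_zero k
  field_simp

lemma hom_eq (A B C : ℂ) (hC : ∀ k : ℤ, C ≠ (k : ℂ)) (d : ℕ → ℂ)
    (hd : ∀ k : ℕ, ((k : ℂ) + 1) * (k + C) * d (k+1) = (k + A) * (k + B) * d k) (k : ℕ) :
    d k = d 0 * hyp A B C k := by
  induction k with
  | zero => simp [hyp]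
  | succ k ih =>
    have := nat_add_ne hC k
    have h2 : (k : ℂ) + 1 ≠ 0 := Nat.cast_add_one_ne_zero k
    apply mul_left_cancel₀ (mul_ne_zero h2 this)
    linear_combination hd k - d 0 * hyp_rec A B C hC k + (k + A) * (k + B) * ih

lemma seq_unique (A B C : ℂ) (hC : ∀ k : ℤ, C ≠ (k : ℂ)) (h : 0 < (C - A - B).re)
    (hCA : ∀ k : ℤ, C - A ≠ (k : ℂ)) (hCB : ∀ k : ℤ, C - B ≠ (k : ℂ)) (c d g : ℕ → ℂ)
    (hc : ∀ k : ℕ, ((k : ℂ) + 1) * (k + C) * c (k+1) - (k + A) * (k + B) * c k = g k)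
    (hd : ∀ k : ℕ, ((k : ℂ) + 1) * (k + C) * d (k+1) - (k + A) * (k + B) * d k = g k)
    (a : ℂ) (hca : HasSum c a) (hda : HasSum d a) : c = d := by
  have h1 := hom_eq A B C hC (fun k => c k - d k) (fun k => by linear_combination hc k - hd k)
  have h2 : HasSum (fun k => (c 0 - d 0) * hyp A B C k) (a - a) :=
    hasSum_cast (hca.sub hda) (fun k => (h1 k).symm) rfl
  have h3 := ((hyp_summable A B C hC h).of_norm.hasSum.mul_left (c 0 - d 0)).unique h2
  rw [sub_self] at h3
  have h4 := (mul_eq_zero.1 h3).resolve_right (hyp_sum_ne A B C hC h hCA hCB)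
  funext k
  have := h1 k
  simp only [h4, zero_mul] at this
  exact sub_eq_zero.1 this

lemma seq_exists (A B C : ℂ) (hC : ∀ k : ℤ, C ≠ (k : ℂ)) (h : 0 < (C - A - B).re)
    (hCA : ∀ k : ℤ, C - A ≠ (k : ℂ)) (hCB : ∀ k : ℤ, C - B ≠ (k : ℂ)) (g : ℕ → ℂ)
    (hg : Summable fun k => ‖g k‖) (a : ℂ) :
    ∃ c : ℕ → ℂ, (Summable fun k => ‖c k‖) ∧ HasSum c a ∧
      ∀ k : ℕ, ((k : ℂ) + 1) * (k + C) * c (k+1) - (k + A) * (k + B) * c k = g k := by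
  have hp := rec_summable A B C h _ g hg (part_rec A B C hC g 0)
  have hh := (hyp_summable A B C hC h).of_norm.hasSum
  have hne := hyp_sum_ne A B C hC h hCA hCB
  set t := (a - ∑' k, part A B C g 0 k) / ∑' k, hyp A B C k with ht
  have hrec : ∀ k : ℕ, ((k : ℂ) + 1) * (k + C) * (part A B C g 0 (k+1) + t * hyp A B C (k+1)) =
      (k + A) * (k + B) * (part A B C g 0 k + t * hyp A B C k) + g k := fun k => by
    linear_combination part_rec A B C hC g 0 k + t * hyp_rec A B C hC k
  refine ⟨fun k => part A B C g 0 k + t * hyp A B C k, rec_summable A B C h _ g hg hrec, ?_, ?_⟩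
  · refine hasSum_cast (hp.of_norm.hasSum.add (hh.mul_left t)) (fun _ => rfl) ?_
    rw [ht]; field_simp; ring
  · intro k
    linear_combination hrec k

/-- Lemma D.4 (lem:property-R): existence and uniqueness (as a function on the closed unit
disc) of the Property-(R) solution with prescribed value at `w = 1` of the inhomogeneous
Gauss hypergeometric equation with right-hand side `w^X g̃(w)`, `X ∈ {0, 1−C}`,
on the slit disc `{|w| < 1} ∖ (−1,0]`. -/
theorem propertyR_solution_exists_unique {A B C : ℂ}
    (hC : ∀ k : ℤ, C ≠ (k : ℂ)) (hre : (C - A - B).re ∈ Set.Ioo (0 : ℝ) 1)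
    (hA : ∀ k : ℤ, A ≠ (k : ℂ)) (hB : ∀ k : ℤ, B ≠ (k : ℂ))
    (hCA : ∀ k : ℤ, C - A ≠ (k : ℂ)) (hCB : ∀ k : ℤ, C - B ≠ (k : ℂ))
    {X : ℂ} (hX : X = 0 ∨ X = 1 - C)
    {g : ℂ → ℂ} (hg : PropertyR g) (a : ℂ) :
    ∃ f : ℂ → ℂ,
      (PropertyR f ∧ f 1 = a ∧
        ∀ w : ℂ, ‖w‖ < 1 → ¬(w.im = 0 ∧ -1 < w.re ∧ w.re ≤ 0) →
          w * (1 - w) *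
              deriv (deriv (fun z : ℂ => Complex.exp (X * Complex.log z) * f z)) w +
            (C - (1 + A + B) * w) *
              deriv (fun z : ℂ => Complex.exp (X * Complex.log z) * f z) w -
            A * B * (Complex.exp (X * Complex.log w) * f w) =
          Complex.exp (X * Complex.log w) * g w) ∧
      ∀ f' : ℂ → ℂ,
        (PropertyR f' ∧ f' 1 = a ∧
          ∀ w : ℂ, ‖w‖ < 1 → ¬(w.im = 0 ∧ -1 < w.re ∧ w.re ≤ 0) →
            w * (1 - w) *
                deriv (deriv (fun z : ℂ => Complex.exp (X * Complex.log z) * f' z)) w +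
              (C - (1 + A + B) * w) *
                deriv (fun z : ℂ => Complex.exp (X * Complex.log z) * f' z) w -
              A * B * (Complex.exp (X * Complex.log w) * f' w) =
            Complex.exp (X * Complex.log w) * g w) →
        Set.EqOn f' f (closedBall 0 1) := by
  obtain ⟨b, hb, hgb⟩ := hg
  have hgP : PSer b g := fun w hw => hgb w hw.le
  set A' := A + X with hA'
  set B' := B + X with hB'
  set C' := C + 2 * X with hC'
  have h1 : ∀ k : ℤ, C' ≠ (k : ℂ) := by
    intro k h
    rcases hX with rfl | rfl
    · exact hC k (by linear_combination h - hC')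
    · exact hC (2 - k) (by push_cast; linear_combination hC' - h)
  have h2 : 0 < (C' - A' - B').re := by
    have : C' - A' - B' = C - A - B := by rw [hA', hB', hC']; ring
    rw [this]; exact hre.1
  have h3 : ∀ k : ℤ, C' - A' ≠ (k : ℂ) := by
    intro k h
    rcases hX with rfl | rfl
    · exact hCA k (by linear_combination h - hC' + hA')
    · exact hA (1 - k) (by push_cast; linear_combination hC' - h - hA')
  have h4 : ∀ k : ℤ, C' - B' ≠ (k : ℂ) := by
    intro k h
    rcases hX with rfl | rfl
    · exact hCB k (by linear_combination h - hC' + hB')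
    · exact hB (1 - k) (by push_cast; linear_combination hC' - h - hB')
  obtain ⟨c, hcs, hca, hcr⟩ := seq_exists A' B' C' h1 h2 h3 h4 b hb a
  have hsum : ∀ w : ℂ, ‖w‖ ≤ 1 → HasSum (fun k => c k * w ^ k) (∑' k, c k * w ^ k) := by
    intro w hw
    refine (Summable.of_norm_bounded hcs fun k => ?_).hasSum
    rw [norm_mul, norm_pow]
    exact mul_le_of_le_one_right (norm_nonneg _) (pow_le_one₀ (norm_nonneg _) hw)
  have hfP : PSer c (fun w => ∑' k, c k * w ^ k) := fun w hw => hsum w hw.le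
  refine ⟨fun w => ∑' k, c k * w ^ k, ⟨⟨c, hcs, hsum⟩, ?_, ?_⟩, ?_⟩
  · simpa using hca.tsum_eq
  · intro w hw hsl
    rw [ode_conj hfP A B C X hX hw hsl]
    congr 1
    have := hfP.op A' B' C' w hw
    simp only [hcr] at this
    exact this.unique (hgP w hw)
  · rintro f' ⟨⟨d, hds, hdf⟩, hd1, hode⟩ w hw
    have hdP : PSer d f' := fun w hw => hdf w hw.le
    have heq := (hdP.op A' B' C').unique hgP (fun w hw hsl => by
      have := hode w hw hsl
      rw [ode_conj hdP A B C X hX hw hsl] at this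
      exact mul_left_cancel₀ (Complex.exp_ne_zero _) this)
    have hda : HasSum d a := by
      have := hdf 1 (by simp)
      simpa [hd1] using this
    obtain rfl := seq_unique A' B' C' h1 h2 h3 h4 d c b (fun k => congrFun heq k) hcr a hda hca
    have hw1 : ‖w‖ ≤ 1 := by simpa using hw
    exact (hdf w hw1).unique (hsum w hw1)
end

section
/- Let A, B, C ∈ ℂ with C ∉ ℤ and Re(1 − C) > 0, let θ₀ ∈ [0, 2π), and let D := {r·e^{iθ} ∈ ℂ : 0 < r < 1, θ ∈ [0,2π), θ ≠ θ₀} (the open unit disc with the origin and one radius removed). Let h be a holomorphic function on D with exp(h(w)) = w for all w ∈ D (a branch of the logarithm on the simply connected set D), let X ∈ {0, 1 − C}, and let g̃ be analytic on the open unit disc. Suppose U ⊆ D is a nonempty connected open set and f is analytic on U and satisfies w(1−w)·f''(w) + (C − (1+A+B)w)·f'(w) − A·B·f(w) = exp(X·h(w))·g̃(w) for all w ∈ U. Then there exist an analytic function F on D and a complex number c such that F = f on U and F(w) → c as w → 0 within D. -/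
open Complex Metric Set Filter

lemma two_sol {U : Set ℂ} (hU : IsOpen U) (hc : IsPreconnected U) (p q f f' f'' y y' y'' v v' v'' : ℂ → ℂ)
  (hf : ∀ w ∈ U, HasDerivAt f (f' w) w) (hf' : ∀ w ∈ U, HasDerivAt f' (f'' w) w)
  (hy : ∀ w ∈ U, HasDerivAt y (y' w) w) (hy' : ∀ w ∈ U, HasDerivAt y' (y'' w) w)
  (hv : ∀ w ∈ U, HasDerivAt v (v' w) w) (hv' : ∀ w ∈ U, HasDerivAt v' (v'' w) w)
  (ef : ∀ w ∈ U, f'' w = p w * f' w + q w * f w)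
  (ey : ∀ w ∈ U, y'' w = p w * y' w + q w * y w)
  (ev : ∀ w ∈ U, v'' w = p w * v' w + q w * v w)
  (hW : ∀ w ∈ U, y w * v' w - y' w * v w ≠ 0) :
  ∃ c d : ℂ, ∀ w ∈ U, f w = c * y w + d * v w := by
  have key : ∀ a a' a'' : ℂ → ℂ, (∀ w ∈ U, HasDerivAt a (a' w) w) → (∀ w ∈ U, HasDerivAt a' (a'' w) w) →
      (∀ w ∈ U, a'' w = p w * a' w + q w * a w) → 
      ∃ c : ℂ, ∀ w ∈ U, (f w * a' w - f' w * a w) / (y w * v' w - y' w * v w) = c := by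
    intro a a' a'' ha ha' ea
    have hd : ∀ w ∈ U, HasDerivAt (fun w => (f w * a' w - f' w * a w) / (y w * v' w - y' w * v w)) 0 w := by
      intro w hw
      have := (((hf w hw).mul (ha' w hw)).sub ((hf' w hw).mul (ha w hw))).div 
        (((hy w hw).mul (hv' w hw)).sub ((hy' w hw).mul (hv w hw))) (hW w hw)
      refine this.congr_deriv ?_
      simp only [Pi.sub_apply, Pi.mul_apply]
      rw [ef w hw, ea w hw, ey w hw, ev w hw]
      have := hW w hw
      rw [div_eq_zero_iff]; left
      ring
    exact hU.exists_is_const_of_deriv_eq_zero hc (fun w hw => (hd w hw).differentiableAt.differentiableWithinAt) (fun w hw => (hd w hw).deriv)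
  obtain ⟨c, h1⟩ := key v v' v'' hv hv' ev
  obtain ⟨d, h2⟩ := key y y' y'' hy hy' ey
  refine ⟨c, -d, fun w hw => ?_⟩
  rw [← h1 w hw, ← h2 w hw]
  have := hW w hw
  calc f w = f w * (y w * v' w - y' w * v w) / (y w * v' w - y' w * v w) := by
        rw [mul_div_cancel_right₀ _ this]
    _ = _ := by ring

lemma wronsk {A B C : ℂ} (y y' y'' u u' u'' : ℂ → ℂ)
  (hy : ∀ w ∈ ball (0:ℂ) 1, HasDerivAt y (y' w) w) (hy' : ∀ w ∈ ball (0:ℂ) 1, HasDerivAt y' (y'' w) w)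
  (hu : ∀ w ∈ ball (0:ℂ) 1, HasDerivAt u (u' w) w) (hu' : ∀ w ∈ ball (0:ℂ) 1, HasDerivAt u' (u'' w) w)
  (ey : ∀ w ∈ ball (0:ℂ) 1, w * (1 - w) * y'' w + (C - (1 + A + B) * w) * y' w - A * B * y w = 0)
  (eu : ∀ w ∈ ball (0:ℂ) 1, w * (1 - w) * u'' w + ((2 - C) - (1 + (A-C+1) + (B-C+1)) * w) * u' w - (A-C+1) * (B-C+1) * u w = 0)
  (h0 : y 0 = 1) (h0' : u 0 = 1) (hC : C ≠ 1) :
  ∀ w ∈ ball (0:ℂ) 1, y w * ((1-C) * u w + w * u' w) - w * y' w * u w ≠ 0 := by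
  have hd : ∀ w ∈ ball (0:ℂ) 1, HasDerivAt (fun w => (y w * ((1-C) * u w + w * u' w) - w * y' w * u w) * Complex.exp ((1+A+B-C) * Complex.log (1 - w))) 0 w := by
    intro w hw
    have hs : 1 - w ∈ slitPlane := by
      left
      have : w.re ≤ ‖w‖ := Complex.re_le_norm w
      simp at hw ⊢; linarith
    have h1 := (((hy w hw).mul (((hu w hw).const_mul (1-C)).add ((hasDerivAt_id w).mul (hu' w hw)))).sub 
        (((hasDerivAt_id w).mul (hy' w hw)).mul (hu w hw))).mul
        ((((((hasDerivAt_id w).const_sub 1).clog hs)).const_mul (1+A+B-C)).cexp)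
    refine h1.congr_deriv ?_
    simp only [Pi.sub_apply, Pi.mul_apply, Pi.add_apply, id]
    have hn : 1 - w ≠ 0 := slitPlane_ne_zero hs
    have e1 := ey w hw
    have e2 := eu w hw
    field_simp
    linear_combination (y w * e2 - u w * e1) * cexp ((1 + A + B - C) * log (1 - w))
  obtain ⟨c, hc⟩ := isOpen_ball.exists_is_const_of_deriv_eq_zero (convex_ball (0:ℂ) 1).isPreconnected (fun w hw => (hd w hw).differentiableAt.differentiableWithinAt) (fun w hw => (hd w hw).deriv)
  intro w hw h
  have a1 := hc w hw
  have a2 := hc 0 (by simp)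
  rw [← a1] at a2
  simp [h, h0, h0'] at a2
  exact hC (sub_eq_zero.1 a2).symm

lemma tw {A B C r : ℂ} {w : ℂ} {e u u' u'' : ℂ → ℂ} (hw : w ≠ 0) 
  (he : HasDerivAt e ((1-C)/w * e w) w)
  (hu : HasDerivAt u (u' w) w) (hu' : HasDerivAt u' (u'' w) w)
  (eu : w * (1 - w) * u'' w + ((2 - C) - (1 + (A-C+1) + (B-C+1)) * w) * u' w - (A-C+1) * (B-C+1) * u w = r) :
  HasDerivAt (fun w => e w * u w) (e w * ((1-C)/w * u w + u' w)) w ∧ 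
  HasDerivAt (fun w => e w * ((1-C)/w * u w + u' w)) (e w * ((1-C)*(-C)/w^2 * u w + 2*(1-C)/w * u' w + u'' w)) w ∧
  w * (1 - w) * (e w * ((1-C)*(-C)/w^2 * u w + 2*(1-C)/w * u' w + u'' w)) + (C - (1 + A + B) * w) * (e w * ((1-C)/w * u w + u' w)) - A * B * (e w * u w) = e w * r := by
  refine ⟨(he.mul hu).congr_deriv (by ring), ?_, ?_⟩
  · refine (he.mul ((((hasDerivAt_const w (1-C)).div (hasDerivAt_id w) hw).mul hu).add hu')).congr_deriv ?_
    simp only [Pi.sub_apply, Pi.mul_apply, Pi.add_apply, Pi.div_apply, id]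
    field_simp; ring
  · rw [← eu]; field_simp; ring


lemma shiftSum {c d : ℕ → ℂ} {w s : ℂ} (h : HasSum (fun n => c n * w ^ n) s) (h0 : d 0 = 0) (h1 : ∀ n, d (n+1) = c n) :
    HasSum (fun n => d n * w ^ n) (w * s) := by
  rw [← hasSum_nat_add_iff' 1]
  simp only [Finset.range_one, Finset.sum_singleton, h0, zero_mul, sub_zero, h1]
  refine (h.mul_left w).congr_fun ?_
  intro n; ring

noncomputable def tc (y : ℂ → ℂ) (n : ℕ) : ℂ := iteratedDeriv n y 0 / (n.factorial : ℂ)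

lemma tc_sum {y : ℂ → ℂ} (hy : DifferentiableOn ℂ y (ball 0 1)) {w : ℂ} (hw : w ∈ ball (0:ℂ) 1) :
    HasSum (fun n => tc y n * w ^ n) (y w) := by
  have := Complex.hasSum_taylorSeries_on_ball hy hw
  refine this.congr_fun ?_
  intro n
  simp [tc, smul_eq_mul]; ring

lemma tc_deriv (y : ℂ → ℂ) (n : ℕ) : tc (deriv y) n = (n + 1) * tc y (n+1) := by
  unfold tc
  rw [iteratedDeriv_succ', Nat.factorial_succ]
  have : (n.factorial : ℂ) ≠ 0 := by exact_mod_cast n.factorial_ne_zero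
  have : (n + 1 : ℂ) ≠ 0 := by exact_mod_cast n.succ_ne_zero
  push_cast
  field_simp

lemma tc_bdd {y : ℂ → ℂ} (hy : DifferentiableOn ℂ y (ball 0 1)) {r : ℝ} (hr : 0 ≤ r) (hr1 : r < 1) :
    ∃ K, ∀ n, ‖tc y n‖ * r ^ n ≤ K := by
  have h := (tc_sum hy (w := (r:ℂ)) (by simpa [abs_of_nonneg hr] using hr1)).summable.tendsto_atTop_zero.norm.bddAbove_range
  obtain ⟨K, hK⟩ := h
  refine ⟨K, fun n => ?_⟩
  have := hK ⟨n, rfl⟩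
  simpa [abs_of_nonneg hr] using this

/-- from bounded coefficients -/
lemma mk_fun (a : ℕ → ℂ) (ha : ∀ r : ℝ, 0 < r → r < 1 → ∃ K, ∀ n, ‖a n‖ * r ^ n ≤ K) :
    ∃ y : ℂ → ℂ, AnalyticOnNhd ℂ y (ball 0 1) ∧ ∀ n, tc y n = a n := by
  set p := FormalMultilinearSeries.ofScalars ℂ a with hp
  have hrad : 1 ≤ p.radius := by
    refine ENNReal.le_of_forall_nnreal_lt fun r hr => ?_
    have hr' : r < 1 := by exact_mod_cast hr
    rcases eq_or_lt_of_le (zero_le (a := r)) with h0 | h0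
    · simp [← h0]
    obtain ⟨K, hK⟩ := ha r h0 hr'
    refine p.le_radius_of_bound K fun n => ?_
    rw [hp, FormalMultilinearSeries.ofScalars_norm]
    exact hK n
  have hps := p.hasFPowerSeriesOnBall (lt_of_lt_of_le one_pos hrad)
  refine ⟨p.sum, ?_, fun n => ?_⟩
  · refine hps.analyticOnNhd.mono ?_
    intro w hw
    rw [Metric.mem_eball, edist_zero_right]
    refine lt_of_lt_of_le ?_ hrad
    have : ‖w‖ < 1 := by simpa using hw
    rw [← ofReal_norm]
    exact ENNReal.ofReal_lt_one.2 this
  · have := hps.factorial_smul 1 n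
    unfold tc
    rw [iteratedDeriv_eq_iteratedFDeriv, ← this]
    have : (n.factorial : ℂ) ≠ 0 := by exact_mod_cast n.factorial_ne_zero
    simp [hp, FormalMultilinearSeries.ofScalars]
    field_simp

noncomputable def recSeq (A B C a0 : ℂ) (b : ℕ → ℂ) : ℕ → ℂ
  | 0 => a0
  | n+1 => ((n + A) * (n + B) * recSeq A B C a0 b n + b n) / ((n + 1) * (n + C))

lemma rec_bdd (A B C a0 : ℂ) (hC : ∀ n : ℕ, (n:ℂ) + C ≠ 0) (b : ℕ → ℂ) (hb : ∀ r : ℝ, 0 < r → r < 1 → ∃ K, ∀ n, ‖b n‖ * r ^ n ≤ K) 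
    (r : ℝ) (hr : 0 < r) (hr1 : r < 1) : ∃ K, ∀ n, ‖recSeq A B C a0 b n‖ * r ^ n ≤ K := by
  obtain ⟨K, hK⟩ := hb r hr hr1
  have t0 : Tendsto (fun n : ℕ => (n : ℂ)⁻¹) atTop (nhds 0) := tendsto_inv_atTop_nhds_zero_nat
  have lim1 : Tendsto (fun n : ℕ => ((n + A) * (n + B)) / ((n + 1) * (n + C))) atTop (nhds (1:ℂ)) := by
    have : Tendsto (fun n : ℕ => ((1 + A * (n:ℂ)⁻¹) * (1 + B * (n:ℂ)⁻¹)) / ((1 + 1 * (n:ℂ)⁻¹) * (1 + C * (n:ℂ)⁻¹))) atTop (nhds (((1 + A * 0) * (1 + B * 0)) / ((1 + 1 * 0) * (1 + C * 0)))) := by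
      refine Tendsto.div ?_ ?_ (by simp)
      · exact ((t0.const_mul A).const_add 1).mul ((t0.const_mul B).const_add 1)
      · exact ((t0.const_mul 1).const_add 1).mul ((t0.const_mul C).const_add 1)
    simp only [mul_zero, add_zero, mul_one, div_one] at this
    refine this.congr' ?_
    filter_upwards [eventually_gt_atTop 0] with n hn
    have h1 : (n:ℂ) ≠ 0 := by exact_mod_cast hn.ne'
    have h2 := hC n
    have h3 : (n + 1 : ℂ) ≠ 0 := by exact_mod_cast n.succ_ne_zero
    field_simp
  have lim2 : Tendsto (fun n : ℕ => 1 / (((n:ℂ) + 1) * (n + C))) atTop (nhds (0:ℂ)) := by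
    have : Tendsto (fun n : ℕ => ((n:ℂ)⁻¹ * (n:ℂ)⁻¹) / ((1 + 1 * (n:ℂ)⁻¹) * (1 + C * (n:ℂ)⁻¹))) atTop (nhds ((0 * 0) / ((1 + 1 * 0) * (1 + C * 0)))) := by
      refine Tendsto.div (t0.mul t0) ?_ (by simp)
      exact ((t0.const_mul 1).const_add 1).mul ((t0.const_mul C).const_add 1)
    simp only [mul_zero, zero_div] at this
    refine this.congr' ?_
    filter_upwards [eventually_gt_atTop 0] with n hn
    have h1 : (n:ℂ) ≠ 0 := by exact_mod_cast hn.ne'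
    have h2 := hC n
    have h3 : (n + 1 : ℂ) ≠ 0 := by exact_mod_cast n.succ_ne_zero
    field_simp
  have e1 : ∀ᶠ n : ℕ in atTop, ‖((n + A) * (n + B)) / ((n + 1) * (n + C))‖ * r < (1 + r) / 2 := by
    have := (lim1.norm.mul_const r)
    exact this.eventually_lt_const (by simp; linarith)
  have e2 : ∀ᶠ n : ℕ in atTop, ‖1 / (((n:ℂ) + 1) * (n + C))‖ < 1 := by
    exact lim2.norm.eventually_lt_const (by simp)
  obtain ⟨N, hN⟩ := (e1.and e2).exists_forall_of_atTop
  set α : ℕ → ℝ := fun n => ‖recSeq A B C a0 b n‖ * r ^ n with hα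
  have hK0 : 0 ≤ K := le_trans (by positivity) (hK 0)
  have step : ∀ n ≥ N, α (n+1) ≤ (1 + r)/2 * α n + K := by
    intro n hn
    obtain ⟨h1, h2⟩ := hN n hn
    have : recSeq A B C a0 b (n+1) = ((n + A) * (n + B)) / ((n + 1) * (n + C)) * recSeq A B C a0 b n + 1 / (((n:ℂ) + 1) * (n + C)) * b n := by
      rw [recSeq]; ring
    simp only [hα]
    rw [this]
    set q := ((n + A) * (n + B)) / ((n + 1) * (n + C))
    set q2 := 1 / (((n:ℂ) + 1) * (n + C))
    set z := recSeq A B C a0 b n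
    calc ‖q * z + q2 * b n‖ * r ^ (n+1) ≤ (‖q‖ * ‖z‖ + ‖q2‖ * ‖b n‖) * r ^ (n+1) := by
          gcongr
          exact (norm_add_le _ _).trans (by simp)
      _ = (‖q‖ * r) * (‖z‖ * r ^ n) + ‖q2‖ * r * (‖b n‖ * r ^ n) := by ring
      _ ≤ (1+r)/2 * (‖z‖ * r ^ n) + 1 * 1 * K := by
          gcongr
          exact hK n
      _ = _ := by ring
  set M := max (α N) (2 * K / (1 - r)) with hM
  have hM2 : (1 + r)/2 * M + K ≤ M := by
    have : 2 * K / (1 - r) ≤ M := le_max_right _ _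
    rw [div_le_iff₀ (by linarith)] at this
    nlinarith
  have big : ∀ n ≥ N, α n ≤ M := by
    intro n hn
    induction n, hn using Nat.le_induction with
    | base => exact le_max_left _ _
    | succ n hn ih =>
      refine (step n hn).trans (le_trans ?_ hM2)
      gcongr
  have hbd : BddAbove (Set.range α) := 
    (Filter.isBoundedUnder_of_eventually_le (f := atTop) (a := M) (eventually_atTop.2 ⟨N, big⟩)).bddAbove_range
  obtain ⟨K', hK'⟩ := hbd
  exact ⟨K', fun n => hK' ⟨n, rfl⟩⟩

lemma ps_sol (A B C a0 : ℂ) (hC : ∀ n : ℕ, (n:ℂ) + C ≠ 0) (g : ℂ → ℂ) (hg : AnalyticOnNhd ℂ g (ball 0 1)) :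
    ∃ y : ℂ → ℂ, AnalyticOnNhd ℂ y (ball 0 1) ∧ y 0 = a0 ∧ ∀ w ∈ ball (0:ℂ) 1,
      w * (1 - w) * deriv (deriv y) w + (C - (1 + A + B) * w) * deriv y w - A * B * y w = g w := by
  obtain ⟨y, hy, hya⟩ := mk_fun (recSeq A B C a0 (tc g)) (rec_bdd A B C a0 hC (tc g) 
    (fun r h1 h2 => tc_bdd hg.differentiableOn h1.le h2))
  refine ⟨y, hy, ?_, ?_⟩
  · have := hya 0
    simpa [tc, recSeq] using this
  intro w hw
  have s0 := tc_sum hy.differentiableOn hw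
  have s1 := tc_sum hy.deriv.differentiableOn hw
  have s2 := tc_sum hy.deriv.deriv.differentiableOn hw
  have s3 := tc_sum hg.differentiableOn hw
  have s1' := shiftSum (d := fun n => n * tc y n) s1 (by simp) (by intro n; rw [tc_deriv]; push_cast; ring)
  have s2' := shiftSum (d := fun n => n * ((n+1) * tc y (n+1))) s2 (by simp) (by intro n; rw [tc_deriv, tc_deriv]; push_cast; ring)
  have s2'' := shiftSum (d := fun n => n * (n - 1) * tc y n) s2' (by simp) (by intro n; push_cast; ring)
  have tot := (((s2'.sub s2'').add (s1.mul_left C)).sub (s1'.mul_left (1+A+B))).sub (s0.mul_left (A*B))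
  have := tot.unique (s3.congr_fun ?_)
  · rw [← this]; ring
  intro n
  rw [tc_deriv, hya, hya, recSeq]
  have h2 := hC n
  have h3 : (n + 1 : ℂ) ≠ 0 := by exact_mod_cast n.succ_ne_zero
  field_simp
  ring

lemma D_eq (θ₀ : ℝ) (hθ₀ : θ₀ ∈ Set.Ico (0 : ℝ) (2 * Real.pi)) :
    {w : ℂ | ∃ r θ : ℝ, 0 < r ∧ r < 1 ∧ θ ∈ Set.Ico (0 : ℝ) (2 * Real.pi) ∧
      θ ≠ θ₀ ∧ w = (r : ℂ) * Complex.exp ((θ : ℂ) * Complex.I)} =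
    {w : ℂ | ‖w‖ < 1 ∧ w * (-Complex.exp (((-θ₀ : ℝ) : ℂ) * Complex.I)) ∈ slitPlane} := by
  have hpi := Real.pi_pos
  ext w
  constructor
  · rintro ⟨r, θ, hr, hr1, hθ, hne, rfl⟩
    refine ⟨by simpa [Complex.norm_exp_ofReal_mul_I, abs_of_pos hr] using hr1, ?_⟩
    have e : (r:ℂ) * Complex.exp ((θ : ℂ) * Complex.I) * (-Complex.exp (((-θ₀ : ℝ) : ℂ) * Complex.I)) = 
      ((-r : ℝ) : ℂ) * Complex.exp (((θ - θ₀ : ℝ) : ℂ) * Complex.I) := by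
      have : (((θ - θ₀ : ℝ) : ℂ) * Complex.I) = (θ : ℂ) * Complex.I + ((-θ₀ : ℝ) : ℂ) * Complex.I := by
        push_cast; ring
      rw [this, Complex.exp_add]; push_cast; ring
    rw [e, Complex.mem_slitPlane_iff, Complex.re_ofReal_mul, Complex.im_ofReal_mul,
      Complex.exp_ofReal_mul_I_re, Complex.exp_ofReal_mul_I_im]
    by_cases hs : Real.sin (θ - θ₀) = 0
    · left
      obtain ⟨k, hk⟩ := Real.sin_eq_zero_iff.1 hs
      have k1 : k < 2 := by
        have : (k:ℝ) < 2 := by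
          by_contra hh
          have : 2 * Real.pi ≤ k * Real.pi := by gcongr; exact not_lt.1 hh
          linarith [hθ.2, hθ₀.1]
        exact_mod_cast this
      have k2 : -2 < k := by
        have : (-2:ℝ) < k := by
          by_contra hh
          have : k * Real.pi ≤ (-2) * Real.pi := by gcongr; exact not_lt.1 hh
          linarith [hθ.1, hθ₀.2]
        exact_mod_cast this
      have k0 : k ≠ 0 := by
        rintro rfl
        apply hne
        simp at hk; linarith
      have hk' : k = 1 ∨ k = -1 := by omega
      have : Real.cos (θ - θ₀) = -1 := by
        rw [← hk]
        rcases hk' with rfl | rfl <;> simp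
      rw [this]; linarith
    · right
      exact mul_ne_zero (by linarith) hs
  · rintro ⟨h1, h2⟩
    have hw : w ≠ 0 := by
      rintro rfl
      simp at h2
    have hr : 0 < ‖w‖ := norm_pos_iff.2 hw
    have key : w = (‖w‖ : ℂ) * Complex.exp (((toIcoMod Real.two_pi_pos 0 w.arg : ℝ) : ℂ) * Complex.I) := by
      have h3 := Complex.norm_mul_exp_arg_mul_I w
      have h4 : ((toIcoMod Real.two_pi_pos 0 w.arg : ℝ) : ℂ) * Complex.I = w.arg * Complex.I - (toIcoDiv Real.two_pi_pos 0 w.arg : ℤ) * (2 * Real.pi * Complex.I) := by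
        rw [toIcoMod]; push_cast; simp; ring
      rw [h4, Complex.exp_sub, Complex.exp_int_mul_two_pi_mul_I, div_one, h3]
    refine ⟨‖w‖, toIcoMod Real.two_pi_pos 0 w.arg, hr, h1, toIcoMod_mem_Ico' _ _, ?_, key⟩
    intro he
    rw [he] at key
    have : w * (-Complex.exp (((-θ₀ : ℝ) : ℂ) * Complex.I)) = ((-‖w‖ : ℝ) : ℂ) := by
      have h5 : Complex.exp ((θ₀ : ℂ) * Complex.I) * Complex.exp (((-θ₀ : ℝ) : ℂ) * Complex.I) = 1 := by
        rw [← Complex.exp_add]; simp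
      calc _ = -((‖w‖ : ℂ) * (Complex.exp ((θ₀ : ℂ) * Complex.I) * Complex.exp (((-θ₀ : ℝ) : ℂ) * Complex.I))) := by
            conv_lhs => rw [key]
            ring
        _ = _ := by rw [h5]; simp
    rw [this, Complex.ofReal_mem_slitPlane] at h2
    linarith

lemma D_open (u : ℂ) : IsOpen {w : ℂ | ‖w‖ < 1 ∧ w * u ∈ slitPlane} :=
  (isOpen_lt continuous_norm continuous_const).inter (isOpen_slitPlane.preimage (by fun_prop : Continuous fun w : ℂ => w * u))

lemma D_conn (u : ℂ) (hu : ‖u‖ = 1) : IsPreconnected {w : ℂ | ‖w‖ < 1 ∧ w * u ∈ slitPlane} := by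
  have hu0 : u ≠ 0 := by rintro rfl; simp at hu
  have hs : StarConvex ℝ ((1/2 : ℝ) : ℂ) (ball (0:ℂ) 1 ∩ slitPlane) := by
    refine StarConvex.inter ((convex_ball (0:ℂ) 1).starConvex ?_) (starConvex_slitPlane (by rw [Complex.zero_lt_real]; norm_num))
    simp; norm_num
  have hp : IsPreconnected (ball (0:ℂ) 1 ∩ slitPlane) := 
    (hs.isPathConnected ⟨by simp; norm_num, by rw [Complex.ofReal_mem_slitPlane]; norm_num⟩).isConnected.isPreconnected
  have := hp.image (fun z => z * u⁻¹) (by fun_prop)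
  convert this using 1
  ext w
  simp only [mem_setOf_eq, mem_image, mem_inter_iff, mem_ball_zero_iff]
  constructor
  · rintro ⟨h1, h2⟩
    exact ⟨w * u, ⟨by simpa [hu] using h1, h2⟩, by field_simp⟩
  · rintro ⟨z, ⟨h1, h2⟩, rfl⟩
    refine ⟨by simpa [hu] using h1, ?_⟩
    rwa [mul_assoc, inv_mul_cancel₀ hu0, mul_one]

lemma h_deriv {D : Set ℂ} (hD : IsOpen D) {h : ℂ → ℂ} (hh : DifferentiableOn ℂ h D) (hl : ∀ w ∈ D, Complex.exp (h w) = w) :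
    ∀ w ∈ D, HasDerivAt h (1 / w) w := by
  intro w hw
  have h1 := (hh.differentiableAt (hD.mem_nhds hw)).hasDerivAt
  have h2 := h1.cexp
  have h3 : HasDerivAt (fun x => Complex.exp (h x)) 1 w := 
    (hasDerivAt_id w).congr_of_eventuallyEq (by filter_upwards [hD.mem_nhds hw] with x hx using hl x hx)
  have h4 := h2.unique h3
  rw [hl w hw] at h4
  have : w ≠ 0 := by rintro rfl; simp at h4
  refine h1.congr_deriv ?_
  field_simp; rw [mul_comm]; exact h4

lemma E_lim (u : ℂ) (hu : ‖u‖ = 1) {D : Set ℂ} (hDe : D = {w : ℂ | ‖w‖ < 1 ∧ w * u ∈ slitPlane}) 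
    {h : ℂ → ℂ} (hh : DifferentiableOn ℂ h D) (hl : ∀ w ∈ D, Complex.exp (h w) = w) (s : ℂ) (hs : 0 < s.re) :
    Tendsto (fun w => Complex.exp (s * h w)) (nhdsWithin 0 D) (nhds 0) := by
  have hu0 : u ≠ 0 := by rintro rfl; simp at hu
  have hDo : IsOpen D := hDe ▸ D_open u
  have hDc : IsPreconnected D := hDe ▸ D_conn u hu
  have hd : ∀ w ∈ D, HasDerivAt (fun w => h w - Complex.log (w * u)) 0 w := by
    intro w hw
    have hw' := hw
    rw [hDe] at hw'
    have hw0 : w ≠ 0 := by rintro rfl; simp at hw'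
    refine ((h_deriv hDo hh hl w hw).sub (((hasDerivAt_id w).mul_const u).clog hw'.2)).congr_deriv ?_
    simp only [id]
    field_simp; simp
  obtain ⟨c, hc⟩ := hDo.exists_is_const_of_deriv_eq_zero hDc (fun w hw => (hd w hw).differentiableAt.differentiableWithinAt) (fun w hw => (hd w hw).deriv)
  have him : ∀ w ∈ D, |(h w).im| ≤ |c.im| + Real.pi := by
    intro w hw
    have : h w = c + Complex.log (w * u) := by rw [← hc w hw]; ring
    rw [this, Complex.add_im]
    refine (abs_add_le _ _).trans ?_
    gcongr
    rw [Complex.log_im]; exact Complex.abs_arg_le_pi _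
  have hre : ∀ w ∈ D, (h w).re = Real.log ‖w‖ := by
    intro w hw
    conv_rhs => rw [← hl w hw]
    rw [Complex.norm_exp, Real.log_exp]
  have hb : ∀ w ∈ D, ‖Complex.exp (s * h w)‖ ≤ ‖w‖ ^ s.re * Real.exp (|s.im| * (|c.im| + Real.pi)) := by
    intro w hw
    have hw0 : 0 < ‖w‖ := by rw [← hl w hw]; simp
    rw [Complex.norm_exp, Real.rpow_def_of_pos hw0, ← Real.exp_add, Complex.mul_re, hre w hw]
    apply Real.exp_le_exp.2
    have : -(s.im * (h w).im) ≤ |s.im| * (|c.im| + Real.pi) := by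
      refine (neg_le_abs _).trans ?_
      rw [abs_mul]
      gcongr
      exact him w hw
    linarith
  refine squeeze_zero_norm' (a := fun w : ℂ => ‖w‖ ^ s.re * Real.exp (|s.im| * (|c.im| + Real.pi))) ?_ ?_
  · filter_upwards [self_mem_nhdsWithin] with w hw using hb w hw
  · have : ContinuousAt (fun w : ℂ => ‖w‖ ^ s.re * Real.exp (|s.im| * (|c.im| + Real.pi))) 0 := by
      refine ContinuousAt.mul ?_ continuousAt_const
      exact continuousAt_id.norm.rpow_const (Or.inr hs.le)
    have h2 := this.tendsto
    simp only [norm_zero, Real.zero_rpow hs.ne', zero_mul] at h2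
    exact h2.mono_left nhdsWithin_le_nhds

/-- final assembly -/
theorem hypergeometric_solution_extends {A B C : ℂ}
    (hC : ∀ k : ℤ, C ≠ (k : ℂ)) (hreC : 0 < (1 - C).re)
    (θ₀ : ℝ) (hθ₀ : θ₀ ∈ Set.Ico (0 : ℝ) (2 * Real.pi))
    (D : Set ℂ)
    (hD : D = {w : ℂ | ∃ r θ : ℝ, 0 < r ∧ r < 1 ∧ θ ∈ Set.Ico (0 : ℝ) (2 * Real.pi) ∧
      θ ≠ θ₀ ∧ w = (r : ℂ) * Complex.exp ((θ : ℂ) * Complex.I)})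
    (h : ℂ → ℂ) (hh : DifferentiableOn ℂ h D) (hhlog : ∀ w ∈ D, Complex.exp (h w) = w)
    {X : ℂ} (hX : X = 0 ∨ X = 1 - C)
    (g : ℂ → ℂ) (hg : AnalyticOnNhd ℂ g (ball 0 1))
    (U : Set ℂ) (hUD : U ⊆ D) (hUopen : IsOpen U) (hUconn : IsConnected U)
    (f : ℂ → ℂ) (hf : AnalyticOnNhd ℂ f U)
    (hode : ∀ w ∈ U,
      w * (1 - w) * deriv (deriv f) w + (C - (1 + A + B) * w) * deriv f w - A * B * f w =
        Complex.exp (X * h w) * g w) :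
    ∃ F : ℂ → ℂ, ∃ c : ℂ, AnalyticOnNhd ℂ F D ∧ Set.EqOn F f U ∧
      Tendsto F (nhdsWithin 0 D) (nhds c) := by
  rw [D_eq θ₀ hθ₀] at hD
  set u0 := -Complex.exp (((-θ₀ : ℝ) : ℂ) * Complex.I) with hu0
  have hu0n : ‖u0‖ = 1 := by rw [hu0, norm_neg, Complex.norm_exp_ofReal_mul_I]
  have hDo : IsOpen D := hD ▸ D_open u0
  have hDb : D ⊆ ball 0 1 := by
    intro w hw; rw [hD] at hw; simpa using hw.1
  have hD0 : ∀ w ∈ D, w ≠ 0 := by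
    intro w hw; rw [← hhlog w hw]; exact Complex.exp_ne_zero _
  have hb1 : ∀ w ∈ ball (0:ℂ) 1, 1 - w ≠ 0 := by
    intro w hw h1
    have : w = 1 := (sub_eq_zero.1 h1).symm
    simp [this] at hw
  have hC1 : ∀ n : ℕ, (n:ℂ) + C ≠ 0 := by
    intro n hn
    apply hC (-n)
    push_cast
    linear_combination hn
  have hC2 : ∀ n : ℕ, (n:ℂ) + (2 - C) ≠ 0 := by
    intro n hn
    apply hC (n + 2)
    push_cast
    linear_combination -hn
  set e : ℂ → ℂ := fun w => Complex.exp ((1 - C) * h w) with he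
  have hed : ∀ w ∈ D, HasDerivAt e ((1 - C) / w * e w) w := by
    intro w hw
    exact (((h_deriv hDo hh hhlog w hw).const_mul (1 - C)).cexp).congr_deriv (by simp only [he]; ring)
  have hea : AnalyticOnNhd ℂ e D := 
    DifferentiableOn.analyticOnNhd (fun w hw => (hed w hw).differentiableAt.differentiableWithinAt) hDo
  have hel : Tendsto e (nhdsWithin 0 D) (nhds 0) := E_lim u0 hu0n hD hh hhlog (1 - C) hreC
  -- basic solutions
  obtain ⟨y, hy, hy0, hyo⟩ := ps_sol A B C 1 hC1 (fun _ => 0) analyticOnNhd_const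
  obtain ⟨v, hv, hv0, hvo⟩ := ps_sol (A - C + 1) (B - C + 1) (2 - C) 1 hC2 (fun _ => 0) analyticOnNhd_const
  have d1 : ∀ {z : ℂ → ℂ} {S : Set ℂ}, AnalyticOnNhd ℂ z S → ∀ w ∈ S, HasDerivAt z (deriv z w) w :=
    fun hz w hw => (hz w hw).differentiableAt.hasDerivAt
  have hW := wronsk (A := A) (B := B) (C := C) y (deriv y) (deriv (deriv y)) v (deriv v) (deriv (deriv v))
    (d1 hy) (d1 hy.deriv) (d1 hv) (d1 hv.deriv) hyo hvo hy0 hv0 (by simpa using hC 1)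
  -- it suffices to find the decomposition
  suffices H : ∃ a b : ℂ → ℂ, AnalyticOnNhd ℂ a (ball 0 1) ∧ AnalyticOnNhd ℂ b (ball 0 1) ∧
      ∀ w ∈ U, f w = a w + e w * b w by
    obtain ⟨a, b, ha, hb, hab⟩ := H
    refine ⟨fun w => a w + e w * b w, a 0, ?_, fun w hw => (hab w hw).symm, ?_⟩
    · exact (ha.mono hDb).add (hea.mul (hb.mono hDb))
    · have h0 : (0:ℂ) ∈ ball (0:ℂ) 1 := by simp
      have ta := ((ha 0 h0).continuousAt.tendsto).mono_left (nhdsWithin_le_nhds (s := D))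
      have tb := ((hb 0 h0).continuousAt.tendsto).mono_left (nhdsWithin_le_nhds (s := D))
      simpa using ta.add (hel.mul tb)
  -- particular solution gives decomposition
  have main : ∀ P P' P'' : ℂ → ℂ, (∀ w ∈ U, HasDerivAt P (P' w) w) → (∀ w ∈ U, HasDerivAt P' (P'' w) w) →
      (∀ w ∈ U, w * (1 - w) * P'' w + (C - (1 + A + B) * w) * P' w - A * B * P w = Complex.exp (X * h w) * g w) →
      ∃ c d : ℂ, ∀ w ∈ U, f w - P w = c * y w + d * (e w * v w) := by
    intro P P' P'' hP hP' hPo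
    have hUb : U ⊆ ball 0 1 := hUD.trans hDb
    have T := fun w (hw : w ∈ U) => tw (A := A) (B := B) (hD0 w (hUD hw)) (hed w (hUD hw)) (d1 hv w (hUb hw)) (d1 hv.deriv w (hUb hw)) (hvo w (hUb hw))
    have solve : ∀ w ∈ U, ∀ z z' z'' : ℂ, w * (1 - w) * z'' + (C - (1 + A + B) * w) * z' - A * B * z = 0 →
        z'' = (-(C - (1 + A + B) * w) / (w * (1 - w))) * z' + (A * B / (w * (1 - w))) * z := by
      intro w hw z z' z'' hz
      have := hD0 w (hUD hw)
      have := hb1 w (hUb hw)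
      field_simp
      linear_combination hz
    refine two_sol hUopen hUconn.isPreconnected (fun w => -(C - (1 + A + B) * w) / (w * (1 - w))) 
      (fun w => A * B / (w * (1 - w))) (fun w => f w - P w) (fun w => deriv f w - P' w) (fun w => deriv (deriv f) w - P'' w)
      y (deriv y) (deriv (deriv y)) _ _ _ 
      (fun w hw => (d1 hf w hw).sub (hP w hw)) (fun w hw => (d1 hf.deriv w hw).sub (hP' w hw))
      (fun w hw => d1 hy w (hUb hw)) (fun w hw => d1 hy.deriv w (hUb hw))
      (fun w hw => (T w hw).1) (fun w hw => (T w hw).2.1) ?_ ?_ ?_ ?_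
    · intro w hw
      exact solve w hw _ _ _ (by linear_combination hode w hw - hPo w hw)
    · intro w hw
      exact solve w hw _ _ _ (hyo w (hUb hw))
    · intro w hw
      exact solve w hw _ _ _ ((T w hw).2.2.trans (mul_zero _))
    · intro w hw hz
      apply hW w (hUb hw)
      have h0 := hD0 w (hUD hw)
      have hE : e w ≠ 0 := Complex.exp_ne_zero _
      have : e w * (y w * ((1-C) * v w + w * deriv v w) - w * deriv y w * v w) = w * 0 := by
        rw [← hz]; field_simp
      simpa [hE] using this
  have hUb : U ⊆ ball 0 1 := hUD.trans hDb
  rcases hX with rfl | rfl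
  · obtain ⟨P, hP, -, hPo⟩ := ps_sol A B C 0 hC1 g hg
    obtain ⟨c, d, hcd⟩ := main P (deriv P) (deriv (deriv P)) (fun w hw => d1 hP w (hUb hw)) 
      (fun w hw => d1 hP.deriv w (hUb hw)) (fun w hw => by rw [hPo w (hUb hw)]; simp)
    refine ⟨fun w => P w + c * y w, fun w => d * v w, hP.add (analyticOnNhd_const.mul hy), analyticOnNhd_const.mul hv, ?_⟩
    intro w hw
    linear_combination hcd w hw
  · obtain ⟨P, hP, -, hPo⟩ := ps_sol (A - C + 1) (B - C + 1) (2 - C) 0 hC2 g hg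
    have T := fun w (hw : w ∈ U) => tw (A := A) (B := B) (hD0 w (hUD hw)) (hed w (hUD hw)) (d1 hP w (hUb hw)) (d1 hP.deriv w (hUb hw)) (hPo w (hUb hw))
    obtain ⟨c, d, hcd⟩ := main _ _ _ (fun w hw => (T w hw).1) (fun w hw => (T w hw).2.1) (fun w hw => (T w hw).2.2)
    refine ⟨fun w => c * y w, fun w => P w + d * v w, analyticOnNhd_const.mul hy, hP.add (analyticOnNhd_const.mul hv), ?_⟩
    intro w hw
    linear_combination hcd w hw
end
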